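/- arXiv:math/0305349 — 4 statements merged into one kernel-verified Lean document; each statement's English description precedes it below -/
import Mathlib

section
/- Let X_t be a continuous-time Markov chain on a finite state space V with transition kernel h_t = e^{t(P−I)}, where P is a transition matrix with stationary distribution π, and let Φ be the conductance profile of P. Then for every ε > 0 and all x, y ∈ V, if t ≥ ∫_{4(π(x) ∧ π(y))}^{4/ε} (8/(u Φ(u)²)) du, then |h_t(x,y)/π(y) − 1| ≤ ε. In particular, the ε-uniform mixing time satisfies τ(ε) ≤ ∫_{4π_*}^{4/ε} (8/(u Φ(u)²)) du, where π_* = min_{x∈V} π(x). -/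
open MeasureTheory Set
open scoped ENNReal Classical

namespace ContTimePaper

variable {V : Type*} [Fintype V] [DecidableEq V]

/-- `π(S) = ∑_{y ∈ S} π(y)`. -/
noncomputable def piS (pi : V → ℝ) (S : Set V) : ℝ := ∑' y : S, pi y

/-- `Q(S, A) = ∑_{s ∈ S, a ∈ A} π(s) P(s, a)`. -/
noncomputable def Qset (pi : V → ℝ) (P : Matrix V V ℝ) (S A : Set V) : ℝ :=
  ∑' s : S, ∑' a : A, pi s * P s a

/-- The conductance `Φ_S = Q(S, Sᶜ)/π(S)`. -/
noncomputable def cond (pi : V → ℝ) (P : Matrix V V ℝ) (S : Set V) : ℝ :=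
  Qset pi P S Sᶜ / piS pi S

/-- The conductance profile `Φ(r)`, constant for `r > 1/2`. -/
noncomputable def profile (pi : V → ℝ) (P : Matrix V V ℝ) (r : ℝ) : ℝ :=
  if r ≤ 1 / 2 then sInf (cond pi P '' {S : Set V | 0 < piS pi S ∧ piS pi S ≤ r})
  else sInf (cond pi P '' {S : Set V | 0 < piS pi S ∧ piS pi S ≤ 1 / 2})

/-- The continuous-time transition kernel `h_t = e^{t(P - I)}`. -/
noncomputable def heat (P : Matrix V V ℝ) (t : ℝ) : Matrix V V ℝ :=
  fun x y => ∑' k : ℕ, t ^ k / (Nat.factorial k) * ((P - 1) ^ k) x y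

set_option linter.unusedSectionVars false
set_option linter.unusedSimpArgs false

lemma piS_eq (pi : V → ℝ) (S : Set V) : piS pi S = ∑ x, if x ∈ S then pi x else 0 := by
  unfold piS
  rw [tsum_subtype S pi, tsum_fintype]
  simp [Set.indicator_apply]

lemma Qset_eq (pi : V → ℝ) (P : Matrix V V ℝ) (S A : Set V) :
    Qset pi P S A = ∑ x, ∑ y, if x ∈ S ∧ y ∈ A then pi x * P x y else 0 := by
  unfold Qset
  have h : ∀ s : V, ∑' a : A, pi s * P s a = ∑ y, if y ∈ A then pi s * P s y else 0 := by
    intro s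
    rw [tsum_subtype A (fun a => pi s * P s a), tsum_fintype]
    simp [Set.indicator_apply]
  simp_rw [h]
  rw [tsum_subtype S (fun s => ∑ y, if y ∈ A then pi s * P s y else 0), tsum_fintype]
  refine Finset.sum_congr rfl fun x _ => ?_
  by_cases hx : x ∈ S <;> simp [Set.indicator_apply, hx]

/-- Twice the Dirichlet form. -/
noncomputable def Dir (pi : V → ℝ) (P : Matrix V V ℝ) (g : V → ℝ) : ℝ :=
  ∑ x, ∑ y, pi x * P x y * (g x - g y) ^ 2

lemma sum_fst (P : Matrix V V ℝ) (pi : V → ℝ) (hp1 : ∀ x, ∑ y, P x y = 1) (a : V → ℝ) :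
    ∑ x, ∑ y, pi x * P x y * a x = ∑ x, pi x * a x := by
  refine Finset.sum_congr rfl fun x _ => ?_
  rw [← Finset.sum_mul, ← Finset.mul_sum, hp1, mul_one]

lemma sum_snd (P : Matrix V V ℝ) (pi : V → ℝ) (hstat : ∀ y, ∑ x, pi x * P x y = pi y)
    (a : V → ℝ) : ∑ x, ∑ y, pi x * P x y * a y = ∑ x, pi x * a x := by
  rw [Finset.sum_comm]
  refine Finset.sum_congr rfl fun x _ => ?_
  rw [← Finset.sum_mul, hstat]

lemma Dir_eq (P : Matrix V V ℝ) (pi : V → ℝ) (hp1 : ∀ x, ∑ y, P x y = 1)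
    (hstat : ∀ y, ∑ x, pi x * P x y = pi y) (g : V → ℝ) :
    Dir pi P g = -(∑ x, pi x * (2 * g x * (∑ y, (P - 1) x y * g y))) := by
  have e : ∀ x, ∑ y, (P - 1) x y * g y = (∑ y, P x y * g y) - g x := by
    intro x
    simp [Matrix.sub_apply, sub_mul, Finset.sum_sub_distrib, Matrix.one_apply]
  simp_rw [e]
  have h1 := sum_fst P pi hp1 (fun x => g x ^ 2)
  have h2 := sum_snd P pi hstat (fun x => g x ^ 2)
  have h3 : Dir pi P g = ∑ x, ∑ y, pi x * P x y * g x ^ 2 + ∑ x, ∑ y, pi x * P x y * g y ^ 2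
      - ∑ x, pi x * (2 * g x * ∑ y, P x y * g y) := by
    unfold Dir
    simp_rw [Finset.mul_sum]
    rw [← Finset.sum_add_distrib, ← Finset.sum_sub_distrib]
    refine Finset.sum_congr rfl fun x _ => ?_
    rw [← Finset.sum_add_distrib, ← Finset.sum_sub_distrib]
    refine Finset.sum_congr rfl fun y _ => ?_
    ring
  rw [h3, h1, h2, ← Finset.sum_add_distrib, ← Finset.sum_sub_distrib, ← Finset.sum_neg_distrib]
  refine Finset.sum_congr rfl fun x _ => ?_
  ring

lemma int_Ico (a b : ℝ) : ∫ s : ℝ, (Ico a b).indicator (fun _ => (1:ℝ)) s = max (b - a) 0 := by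
  rw [integral_indicator measurableSet_Ico]
  simp [Measure.real, Real.volume_Ico, ENNReal.toReal_ofReal']

lemma integrable_Ico (a b : ℝ) : Integrable ((Ico a b).indicator (fun _ => (1:ℝ))) := by
  rw [integrable_indicator_iff measurableSet_Ico]
  simp

lemma coarea (P : Matrix V V ℝ) (pi : V → ℝ) (hp0 : ∀ x y, 0 ≤ P x y)
    (hpipos : ∀ x, 0 < pi x) (r φ : ℝ)
    (hφ : ∀ S : Set V, 0 < piS pi S → piS pi S ≤ r → φ * piS pi S ≤ Qset pi P S Sᶜ)
    (k : V → ℝ) (hk : ∀ x, 0 ≤ k x) (hs : piS pi {x | 0 < k x} ≤ r) :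
    φ * ∑ x, pi x * k x ≤ ∑ x, ∑ y, pi x * P x y * max (k x - k y) 0 := by
  have h1 : φ * ∑ x, pi x * k x =
      ∫ s : ℝ, φ * ∑ x, pi x * (Ico 0 (k x)).indicator (fun _ => (1:ℝ)) s := by
    rw [integral_const_mul, integral_finsetSum]
    · congr 1
      refine Finset.sum_congr rfl fun x _ => ?_
      rw [integral_const_mul, int_Ico, sub_zero, max_eq_left (hk x)]
    · intro x _
      exact (integrable_Ico _ _).const_mul _
  have i2 : ∀ x y, Integrable
      (fun s => pi x * P x y * (Ico (k y) (k x)).indicator (fun _ => (1:ℝ)) s) :=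
    fun x y => (integrable_Ico _ _).const_mul _
  have h2 : ∑ x, ∑ y, pi x * P x y * max (k x - k y) 0 =
      ∫ s : ℝ, ∑ x, ∑ y, pi x * P x y * (Ico (k y) (k x)).indicator (fun _ => (1:ℝ)) s := by
    rw [integral_finsetSum _ (fun x _ => integrable_finsetSum _ fun y _ => i2 x y)]
    refine Finset.sum_congr rfl fun x _ => ?_
    rw [integral_finsetSum _ (fun y _ => i2 x y)]
    refine Finset.sum_congr rfl fun y _ => ?_
    rw [integral_const_mul, int_Ico]
  rw [h1, h2]
  refine integral_mono ?_ ?_ ?_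
  · exact (integrable_finsetSum _ fun x _ => (integrable_Ico _ _).const_mul _).const_mul _
  · exact integrable_finsetSum _ fun x _ => integrable_finsetSum _ fun y _ => i2 x y
  · intro s
    show φ * ∑ x, pi x * (Ico 0 (k x)).indicator (fun _ => (1:ℝ)) s ≤
      ∑ x, ∑ y, pi x * P x y * (Ico (k y) (k x)).indicator (fun _ => (1:ℝ)) s
    have hR : 0 ≤ ∑ x, ∑ y, pi x * P x y * (Ico (k y) (k x)).indicator (fun _ => (1:ℝ)) s := by
      refine Finset.sum_nonneg fun x _ => Finset.sum_nonneg fun y _ => ?_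
      exact mul_nonneg (mul_nonneg (hpipos x).le (hp0 x y))
        (Set.indicator_nonneg (fun _ _ => zero_le_one) _)
    rcases lt_or_ge s 0 with hs0 | hs0
    · have : ∑ x, pi x * (Ico 0 (k x)).indicator (fun _ => (1:ℝ)) s = 0 := by
        refine Finset.sum_eq_zero fun x _ => ?_
        simp [Set.indicator_apply, not_le.mpr hs0]
      rw [this, mul_zero]; exact hR
    · have e1 : ∑ x, pi x * (Ico 0 (k x)).indicator (fun _ => (1:ℝ)) s = piS pi {x | s < k x} := by
        rw [piS_eq]
        refine Finset.sum_congr rfl fun x _ => ?_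
        simp [Set.indicator_apply, hs0]
      have e2 : ∑ x, ∑ y, pi x * P x y * (Ico (k y) (k x)).indicator (fun _ => (1:ℝ)) s =
          Qset pi P {x | s < k x} {x | s < k x}ᶜ := by
        rw [Qset_eq]
        refine Finset.sum_congr rfl fun x _ => Finset.sum_congr rfl fun y _ => ?_
        simp [Set.indicator_apply, and_comm]
      rw [e2] at hR
      rw [e1, e2]
      rcases le_or_gt (piS pi {x | s < k x}) 0 with h0 | h0
      · have : piS pi {x | s < k x} = 0 := by
          refine le_antisymm h0 ?_
          rw [piS_eq]
          refine Finset.sum_nonneg fun x _ => ?_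
          split_ifs
          exacts [(hpipos x).le, le_rfl]
        rw [this, mul_zero]; exact hR
      · refine hφ _ h0 (le_trans ?_ hs)
        rw [piS_eq, piS_eq]
        refine Finset.sum_le_sum fun x _ => ?_
        simp only [mem_ofPred_eq]
        split_ifs with c1 c2
        · exact le_rfl
        · exact absurd (lt_of_le_of_lt hs0 c1) c2
        · exact (hpipos x).le
        · exact le_rfl

lemma cheeger (P : Matrix V V ℝ) (pi : V → ℝ) (hp0 : ∀ x y, 0 ≤ P x y)
    (hp1 : ∀ x, ∑ y, P x y = 1)
    (hstat : ∀ y, ∑ x, pi x * P x y = pi y)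
    (hpipos : ∀ x, 0 < pi x) (r φ : ℝ) (hφ0 : 0 ≤ φ)
    (hφ : ∀ S : Set V, 0 < piS pi S → piS pi S ≤ r → φ * piS pi S ≤ Qset pi P S Sᶜ)
    (g : V → ℝ) (hg : ∀ x, 0 ≤ g x) (hs : piS pi {x | 0 < g x} ≤ r) :
    φ ^ 2 * ∑ x, pi x * g x ^ 2 ≤ Dir pi P g := by
  have hQ : ∀ x y, 0 ≤ pi x * P x y := fun x y => mul_nonneg (hpipos x).le (hp0 x y)
  have hc := coarea P pi hp0 hpipos r φ hφ (fun x => g x ^ 2) (fun x => sq_nonneg _) (by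
    have hset : {x | 0 < g x ^ 2} = {x | 0 < g x} := by
      ext x
      simp only [mem_ofPred_eq]
      constructor
      · intro h
        rcases (hg x).lt_or_eq with h' | h'
        · exact h'
        · rw [← h'] at h; norm_num at h
      · intro h; positivity
    rw [hset]; exact hs)
  have h1 := sum_fst P pi hp1 (fun x => g x ^ 2)
  have h2 := sum_snd P pi hstat (fun x => g x ^ 2)
  set E := ∑ x, pi x * g x ^ 2 with hE
  have hE0 : 0 ≤ E := Finset.sum_nonneg fun x _ => mul_nonneg (hpipos x).le (sq_nonneg _)
  -- half absolute value
  have h3 : ∑ x, ∑ y, pi x * P x y * max (g x ^ 2 - g y ^ 2) 0 =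
      1 / 2 * ∑ x, ∑ y, pi x * P x y * (|g x - g y| * (g x + g y)) := by
    have : ∑ x, ∑ y, pi x * P x y * max (g x ^ 2 - g y ^ 2) 0 =
      1 / 2 * (∑ x, ∑ y, pi x * P x y * (|g x - g y| * (g x + g y)) +
        (∑ x, ∑ y, pi x * P x y * g x ^ 2 - ∑ x, ∑ y, pi x * P x y * g y ^ 2)) := by
      rw [← Finset.sum_sub_distrib, ← Finset.sum_add_distrib, Finset.mul_sum]
      refine Finset.sum_congr rfl fun x _ => ?_
      rw [← Finset.sum_sub_distrib, ← Finset.sum_add_distrib, Finset.mul_sum]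
      refine Finset.sum_congr rfl fun y _ => ?_
      have hx := hg x
      have hy := hg y
      rcases le_total (g x) (g y) with h | h
      · rw [max_eq_right (by nlinarith), abs_of_nonpos (by linarith)]; ring
      · rw [max_eq_left (by nlinarith), abs_of_nonneg (by linarith)]; ring
    rw [this, h1, h2]; ring
  have h4 : ∑ x, ∑ y, pi x * P x y * (g x + g y) ^ 2 ≤ 4 * E := by
    have : ∑ x, ∑ y, pi x * P x y * (g x + g y) ^ 2 ≤
        2 * (∑ x, ∑ y, pi x * P x y * g x ^ 2 + ∑ x, ∑ y, pi x * P x y * g y ^ 2) := by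
      rw [← Finset.sum_add_distrib, Finset.mul_sum]
      refine Finset.sum_le_sum fun x _ => ?_
      rw [← Finset.sum_add_distrib, Finset.mul_sum]
      refine Finset.sum_le_sum fun y _ => ?_
      nlinarith [mul_nonneg (hQ x y) (sq_nonneg (g x - g y))]
    rw [h1, h2] at this; linarith
  have h5 : (∑ x, ∑ y, pi x * P x y * (|g x - g y| * (g x + g y))) ^ 2 ≤
      Dir pi P g * ∑ x, ∑ y, pi x * P x y * (g x + g y) ^ 2 := by
    unfold Dir
    simp_rw [← Finset.sum_product', Finset.univ_product_univ]
    have := Finset.sum_mul_sq_le_sq_mul_sq (Finset.univ : Finset (V × V))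
      (fun p => Real.sqrt (pi p.1 * P p.1 p.2) * |g p.1 - g p.2|)
      (fun p => Real.sqrt (pi p.1 * P p.1 p.2) * (g p.1 + g p.2))
    simp only [mul_pow, Real.sq_sqrt (hQ _ _), sq_abs] at this
    refine le_trans (le_of_eq ?_) this
    congr 1
    refine Finset.sum_congr rfl fun p _ => ?_
    have := Real.mul_self_sqrt (hQ p.1 p.2)
    linear_combination (-|g p.1 - g p.2| * (g p.1 + g p.2)) * this
  have hD0 : 0 ≤ Dir pi P g := Finset.sum_nonneg fun x _ => Finset.sum_nonneg fun y _ =>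
    mul_nonneg (hQ x y) (sq_nonneg _)
  rw [h3] at hc
  set A := ∑ x, ∑ y, pi x * P x y * (|g x - g y| * (g x + g y))
  have h6 : (φ * E) ^ 2 ≤ (1 / 2 * A) ^ 2 := pow_le_pow_left₀ (mul_nonneg hφ0 hE0) hc 2
  have h7 : (φ * E) ^ 2 ≤ Dir pi P g * E := by nlinarith [mul_le_mul_of_nonneg_left h4 hD0]
  rcases hE0.lt_or_eq with h | h
  · nlinarith
  · rw [← h]; simpa using hD0

lemma median [Nonempty V] (pi : V → ℝ) (hpipos : ∀ x, 0 < pi x) (hpi1 : ∑ x, pi x = 1)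
    (f : V → ℝ) : ∃ m : ℝ, piS pi {x | m < f x} ≤ 1 / 2 ∧ piS pi {x | f x < m} ≤ 1 / 2 := by
  obtain ⟨xm, hxm⟩ := Finite.exists_max f
  obtain ⟨x0, h0, h0m⟩ := Set.exists_min_image {x | piS pi {y | f x < f y} ≤ 1 / 2} f
    (Set.toFinite _) ⟨xm, by
      have : {y | f xm < f y} = ∅ := by
        ext y; simpa using hxm y
      rw [mem_ofPred_eq, this, piS_eq]; simp⟩
  refine ⟨f x0, h0, ?_⟩
  by_contra hlt
  push Not at hlt
  have hne : {x | f x < f x0}.Nonempty := by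
    by_contra h
    rw [Set.not_nonempty_iff_eq_empty] at h
    rw [h, piS_eq] at hlt
    norm_num at hlt
  obtain ⟨x1, h1, h1m⟩ := Set.exists_max_image {x | f x < f x0} f (Set.toFinite _) hne
  have hx1 : ¬ piS pi {y | f x1 < f y} ≤ 1 / 2 := fun h => absurd (h0m x1 h) (not_le.mpr h1)
  push Not at hx1
  have : piS pi {y | f x1 < f y} + piS pi {x | f x < f x0} = 1 := by
    rw [← hpi1, piS_eq, piS_eq, ← Finset.sum_add_distrib]
    refine Finset.sum_congr rfl fun x _ => ?_
    simp only [mem_ofPred_eq]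
    by_cases hx : f x < f x0
    · have := h1m x hx
      simp [hx, this]
    · have : f x1 < f x := lt_of_lt_of_le h1 (not_lt.mp hx)
      simp [hx, this]
  linarith

lemma Dir_split (P : Matrix V V ℝ) (pi : V → ℝ) (hp0 : ∀ x y, 0 ≤ P x y)
    (hpipos : ∀ x, 0 < pi x) (f : V → ℝ) (m : ℝ) :
    Dir pi P (fun x => max (f x - m) 0) + Dir pi P (fun x => max (m - f x) 0) ≤ Dir pi P f := by
  unfold Dir
  rw [← Finset.sum_add_distrib]
  refine Finset.sum_le_sum fun x _ => ?_
  rw [← Finset.sum_add_distrib]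
  refine Finset.sum_le_sum fun y _ => ?_
  rw [← mul_add]
  refine mul_le_mul_of_nonneg_left ?_ (mul_nonneg (hpipos x).le (hp0 x y))
  beta_reduce
  rcases le_total (f x) m with h | h <;> rcases le_total (f y) m with h' | h'
  · rw [max_eq_right (sub_nonpos.mpr h), max_eq_right (sub_nonpos.mpr h'),
      max_eq_left (sub_nonneg.mpr h), max_eq_left (sub_nonneg.mpr h')]; nlinarith
  · rw [max_eq_right (sub_nonpos.mpr h), max_eq_left (sub_nonneg.mpr h'),
      max_eq_left (sub_nonneg.mpr h), max_eq_right (sub_nonpos.mpr h')]; nlinarith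
  · rw [max_eq_left (sub_nonneg.mpr h), max_eq_right (sub_nonpos.mpr h'),
      max_eq_right (sub_nonpos.mpr h), max_eq_left (sub_nonneg.mpr h')]; nlinarith
  · rw [max_eq_left (sub_nonneg.mpr h), max_eq_left (sub_nonneg.mpr h'),
      max_eq_right (sub_nonpos.mpr h), max_eq_right (sub_nonpos.mpr h')]; nlinarith

lemma Dir_nonneg (P : Matrix V V ℝ) (pi : V → ℝ) (hp0 : ∀ x y, 0 ≤ P x y)
    (hpipos : ∀ x, 0 < pi x) (f : V → ℝ) : 0 ≤ Dir pi P f :=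
  Finset.sum_nonneg fun x _ => Finset.sum_nonneg fun y _ =>
    mul_nonneg (mul_nonneg (hpipos x).le (hp0 x y)) (sq_nonneg _)

lemma piS_nonneg (pi : V → ℝ) (hpipos : ∀ x, 0 < pi x) (S : Set V) : 0 ≤ piS pi S := by
  rw [piS_eq]
  refine Finset.sum_nonneg fun x _ => ?_
  split_ifs
  exacts [(hpipos x).le, le_rfl]

lemma Qset_nonneg (P : Matrix V V ℝ) (pi : V → ℝ) (hp0 : ∀ x y, 0 ≤ P x y)
    (hpipos : ∀ x, 0 < pi x) (S A : Set V) : 0 ≤ Qset pi P S A := by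
  rw [Qset_eq]
  refine Finset.sum_nonneg fun x _ => Finset.sum_nonneg fun y _ => ?_
  split_ifs
  exacts [mul_nonneg (hpipos x).le (hp0 x y), le_rfl]

lemma profile_mul_le (P : Matrix V V ℝ) (pi : V → ℝ) (r : ℝ) (S : Set V) (h0 : 0 < piS pi S)
    (hr : piS pi S ≤ r) (h2 : piS pi S ≤ 1 / 2) :
    profile pi P r * piS pi S ≤ Qset pi P S Sᶜ := by
  rw [← le_div_iff₀ h0]
  change _ ≤ cond pi P S
  unfold profile
  split_ifs
  · exact csInf_le (Set.toFinite _).bddBelow ⟨S, ⟨h0, hr⟩, rfl⟩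
  · exact csInf_le (Set.toFinite _).bddBelow ⟨S, ⟨h0, h2⟩, rfl⟩

lemma profile_nonneg (P : Matrix V V ℝ) (pi : V → ℝ) (hp0 : ∀ x y, 0 ≤ P x y)
    (hpipos : ∀ x, 0 < pi x) (r : ℝ) : 0 ≤ profile pi P r := by
  unfold profile
  split_ifs <;>
  · apply Real.sInf_nonneg
    rintro _ ⟨S, _, rfl⟩
    exact div_nonneg (Qset_nonneg P pi hp0 hpipos _ _) (piS_nonneg pi hpipos _)

lemma cond_pos (P : Matrix V V ℝ) (pi : V → ℝ) (hp0 : ∀ x y, 0 ≤ P x y)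
    (hpipos : ∀ x, 0 < pi x) (hpi1 : ∑ x, pi x = 1)
    (hirr : ∀ x y : V, ∃ n : ℕ, 0 < (P ^ n) x y)
    (S : Set V) (h0 : 0 < piS pi S) (h2 : piS pi S ≤ 1 / 2) : 0 < cond pi P S := by
  refine div_pos ?_ h0
  refine lt_of_le_of_ne (Qset_nonneg P pi hp0 hpipos _ _) fun hQ => ?_
  have hz : ∀ x ∈ S, ∀ y ∉ S, P x y = 0 := by
    intro x hx y hy
    rw [Qset_eq] at hQ
    have a1 := (Finset.sum_eq_zero_iff_of_nonneg (fun x _ => Finset.sum_nonneg fun y _ => by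
      split_ifs
      exacts [mul_nonneg (hpipos x).le (hp0 x y), le_rfl])).mp hQ.symm x (Finset.mem_univ x)
    have a2 := (Finset.sum_eq_zero_iff_of_nonneg (fun y _ => by
      split_ifs
      exacts [mul_nonneg (hpipos x).le (hp0 x y), le_rfl])).mp a1 y (Finset.mem_univ y)
    simp only [hx, mem_compl_iff, hy, not_false_eq_true, and_self, if_true] at a2
    exact (mul_eq_zero.mp a2).resolve_left (hpipos x).ne'
  have hpow : ∀ n : ℕ, ∀ x ∈ S, ∀ y ∉ S, (P ^ n) x y = 0 := by
    intro n
    induction n with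
    | zero =>
      intro x hx y hy
      have : x ≠ y := by rintro rfl; exact hy hx
      simp [this]
    | succ n ih =>
      intro x hx y hy
      rw [pow_succ, Matrix.mul_apply]
      refine Finset.sum_eq_zero fun z _ => ?_
      by_cases hz' : z ∈ S
      · rw [hz z hz' y hy, mul_zero]
      · rw [ih x hx z hz', zero_mul]
  have hx : ∃ x, x ∈ S := by
    by_contra h
    push Not at h
    rw [piS_eq] at h0
    simp [h] at h0
  have hy : ∃ y, y ∉ S := by
    by_contra h
    push Not at h
    rw [piS_eq] at h2
    simp [h, hpi1] at h2
    norm_num at h2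
  obtain ⟨x, hx⟩ := hx
  obtain ⟨y, hy⟩ := hy
  obtain ⟨n, hn⟩ := hirr x y
  rw [hpow n x hx y hy] at hn
  exact lt_irrefl _ hn

lemma profile_pos (P : Matrix V V ℝ) (pi : V → ℝ) (hp0 : ∀ x y, 0 ≤ P x y)
    (hpipos : ∀ x, 0 < pi x) (hpi1 : ∑ x, pi x = 1)
    (hirr : ∀ x y : V, ∃ n : ℕ, 0 < (P ^ n) x y)
    (hV : ∃ z, pi z ≤ 1 / 2) (y : V) (r : ℝ) (hr : pi y ≤ r) : 0 < profile pi P r := by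
  have hs : ∀ z, piS pi {z} = pi z := by
    intro z; rw [piS_eq]; simp
  unfold profile
  split_ifs with h
  · obtain ⟨S, hS, hS'⟩ := Set.Nonempty.csInf_mem (s := cond pi P '' {S : Set V | 0 < piS pi S ∧ piS pi S ≤ r})
      (⟨_, {y}, ⟨by rw [hs]; exact hpipos y, by rw [hs]; exact hr⟩, rfl⟩) (Set.toFinite _)
    rw [← hS']
    exact cond_pos P pi hp0 hpipos hpi1 hirr S hS.1 (hS.2.trans h)
  · obtain ⟨z, hz⟩ := hV
    obtain ⟨S, hS, hS'⟩ := Set.Nonempty.csInf_mem (s := cond pi P '' {S : Set V | 0 < piS pi S ∧ piS pi S ≤ 1 / 2})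
      (⟨_, {z}, ⟨by rw [hs]; exact hpipos z, by rw [hs]; exact hz⟩, rfl⟩) (Set.toFinite _)
    rw [← hS']
    exact cond_pos P pi hp0 hpipos hpi1 hirr S hS.1 hS.2

/-- Spectral-profile type inequality. -/
lemma key [Nonempty V] (P : Matrix V V ℝ) (pi : V → ℝ) (hp0 : ∀ x y, 0 ≤ P x y)
    (hp1 : ∀ x, ∑ y, P x y = 1)
    (hstat : ∀ y, ∑ x, pi x * P x y = pi y)
    (hpipos : ∀ x, 0 < pi x) (hpi1 : ∑ x, pi x = 1)
    (f : V → ℝ) (hf : ∀ x, 0 ≤ f x) (hf1 : ∑ x, pi x * f x = 1) (W : ℝ)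
    (hW : W = ∑ x, pi x * f x ^ 2 - 1) (hW0 : 0 < W) :
    profile pi P (4 / W) ^ 2 * (W / 2) ≤ Dir pi P f := by
  have hφ0 := profile_nonneg P pi hp0 hpipos (4 / W)
  rcases le_or_gt (4 / W) (1 / 2) with h | h
  · set c := W / 4 with hc
    have hc0 : 0 < c := by positivity
    have h1 := cheeger P pi hp0 hp1 hstat hpipos (4 / W) _ hφ0
      (fun S a b => profile_mul_le P pi (4 / W) S a b (b.trans h))
      (fun x => max (f x - c) 0) (fun x => le_max_right _ _) (by
        have : c * piS pi {x | 0 < max (f x - c) 0} ≤ 1 := by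
          rw [← hf1, piS_eq, Finset.mul_sum]
          refine Finset.sum_le_sum fun x _ => ?_
          split_ifs with hx
          · simp only [mem_ofPred_eq, lt_max_iff, lt_irrefl, or_false] at hx
            nlinarith [hpipos x]
          · rw [mul_zero]; exact mul_nonneg (hpipos x).le (hf x)
        rw [le_div_iff₀ hW0]
        rw [hc] at this ⊢
        nlinarith)
    have h2 := Dir_split P pi hp0 hpipos f c
    have h3 := Dir_nonneg P pi hp0 hpipos (fun x => max (c - f x) 0)
    have h4 : W / 2 ≤ ∑ x, pi x * (max (f x - c) 0) ^ 2 := by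
      have : ∑ x, pi x * f x ^ 2 - 2 * c * ∑ x, pi x * f x ≤ ∑ x, pi x * (max (f x - c) 0) ^ 2 := by
        rw [Finset.mul_sum, ← Finset.sum_sub_distrib]
        refine Finset.sum_le_sum fun x _ => ?_
        have : f x ^ 2 - 2 * c * f x ≤ (max (f x - c) 0) ^ 2 := by
          rcases le_total (f x) c with h | h
          · rw [max_eq_right (by linarith)]; nlinarith [hf x]
          · rw [max_eq_left (by linarith)]; nlinarith
        nlinarith [mul_le_mul_of_nonneg_left this (hpipos x).le]
      rw [hf1] at this
      linarith
    have := mul_le_mul_of_nonneg_left h4 (sq_nonneg (profile pi P (4 / W)))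
    linarith
  · obtain ⟨m, hm1, hm2⟩ := median pi hpipos hpi1 f
    have hφ : ∀ S : Set V, 0 < piS pi S → piS pi S ≤ 1 / 2 →
        profile pi P (4 / W) * piS pi S ≤ Qset pi P S Sᶜ :=
      fun S a b => profile_mul_le P pi (4 / W) S a (b.trans h.le) b
    have h1 := cheeger P pi hp0 hp1 hstat hpipos (1 / 2) _ hφ0 hφ
      (fun x => max (f x - m) 0) (fun x => le_max_right _ _) (by simpa using hm1)
    have h2 := cheeger P pi hp0 hp1 hstat hpipos (1 / 2) _ hφ0 hφ
      (fun x => max (m - f x) 0) (fun x => le_max_right _ _) (by simpa using hm2)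
    have h3 := Dir_split P pi hp0 hpipos f m
    have h4 : ∑ x, pi x * (max (f x - m) 0) ^ 2 + ∑ x, pi x * (max (m - f x) 0) ^ 2 =
        ∑ x, pi x * f x ^ 2 - 2 * m * ∑ x, pi x * f x + m ^ 2 * ∑ x, pi x := by
      rw [Finset.mul_sum, Finset.mul_sum, ← Finset.sum_add_distrib, ← Finset.sum_sub_distrib,
        ← Finset.sum_add_distrib]
      refine Finset.sum_congr rfl fun x _ => ?_
      rcases le_total (f x) m with h | h
      · rw [max_eq_right (by linarith), max_eq_left (by linarith)]; ring
      · rw [max_eq_left (by linarith), max_eq_right (by linarith)]; ring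
    rw [hf1, hpi1] at h4
    have h5 : W / 2 ≤ ∑ x, pi x * (max (f x - m) 0) ^ 2 + ∑ x, pi x * (max (m - f x) 0) ^ 2 := by
      rw [h4]; nlinarith [sq_nonneg (m - 1)]
    have := mul_le_mul_of_nonneg_left h5 (sq_nonneg (profile pi P (4 / W)))
    linarith

section expo
open scoped Matrix.Norms.Operator

lemma hasSum_exp_apply (A : Matrix V V ℝ) (t : ℝ) (x y : V) :
    HasSum (fun k : ℕ => t ^ k / (Nat.factorial k) * (A ^ k) x y)
      (NormedSpace.exp (t • A) x y) := by
  have h := NormedSpace.exp_series_hasSum_exp' (𝕂 := ℝ) (t • A)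
  have h2 := (Pi.hasSum.mp ((Pi.hasSum.mp h) x)) y
  refine h2.congr_fun ?_
  intro k
  simp [smul_pow]
  ring

lemma heat_eq (P : Matrix V V ℝ) (t : ℝ) : heat P t = NormedSpace.exp (t • (P - 1)) := by
  ext x y
  exact (hasSum_exp_apply (P - 1) t x y).tsum_eq

lemma heat_zero (P : Matrix V V ℝ) : heat P 0 = 1 := by
  rw [heat_eq, zero_smul, NormedSpace.exp_zero]

lemma heat_add (P : Matrix V V ℝ) (s t : ℝ) : heat P (s + t) = heat P s * heat P t := by
  rw [heat_eq, heat_eq, heat_eq, add_smul, Matrix.exp_add_of_commute]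
  exact ((Commute.refl (P - 1)).smul_left s).smul_right t

lemma heat_nonneg (P : Matrix V V ℝ) (hp0 : ∀ x y, 0 ≤ P x y) (t : ℝ) (ht : 0 ≤ t) (x y : V) :
    0 ≤ heat P t x y := by
  have hpow : ∀ (k : ℕ) x y, 0 ≤ (P ^ k) x y := by
    intro k
    induction k with
    | zero => intro x y; rw [pow_zero, Matrix.one_apply]; split_ifs <;> norm_num
    | succ k ih =>
      intro x y
      rw [pow_succ, Matrix.mul_apply]
      exact Finset.sum_nonneg fun z _ => mul_nonneg (ih x z) (hp0 z y)
  have h1 : 0 ≤ NormedSpace.exp (t • P) x y :=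
    (hasSum_exp_apply P t x y).nonneg fun k => mul_nonneg (by positivity) (hpow k x y)
  have e : t • (P - 1) = Matrix.diagonal (fun _ : V => -t) + t • P := by
    have : Matrix.diagonal (fun _ : V => -t) = (-t) • (1 : Matrix V V ℝ) := by
      rw [Matrix.smul_one_eq_diagonal]
    rw [this, smul_sub, neg_smul]; abel
  have hc : Commute (Matrix.diagonal (fun _ : V => -t)) (t • P) := by
    rw [← Matrix.smul_one_eq_diagonal]
    exact (Commute.one_left _).smul_left _
  rw [heat_eq, e, Matrix.exp_add_of_commute _ _ hc, Matrix.exp_diagonal, Matrix.diagonal_mul]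
  refine mul_nonneg ?_ h1
  rw [Pi.coe_exp, ← Real.exp_eq_exp_ℝ]
  exact (Real.exp_pos _).le

lemma heat_deriv (P : Matrix V V ℝ) (t : ℝ) (x y : V) :
    HasDerivAt (fun s => heat P s x y) (∑ w, (P - 1) x w * heat P t w y) t := by
  have h := hasDerivAt_exp_smul_const' (𝕂 := ℝ) (P - 1) t
  have h2 := hasDerivAt_pi.mp (hasDerivAt_pi.mp h x) y
  simp_rw [heat_eq]
  exact h2

end expo

lemma decay [Nonempty V] (P : Matrix V V ℝ) (pi : V → ℝ) (hp0 : ∀ x y, 0 ≤ P x y)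
    (hp1 : ∀ x, ∑ y, P x y = 1)
    (hstat : ∀ y, ∑ x, pi x * P x y = pi y)
    (hpipos : ∀ x, 0 < pi x) (hpi1 : ∑ x, pi x = 1) (y : V)
    (hpos : (∃ z, pi z ≤ 1 / 2) → ∀ r, pi y ≤ r → 0 < profile pi P r)
    (ε : ℝ) (hε : 0 < ε) (T : ℝ) (hT : 0 ≤ T)
    (hI : (∫⁻ u in Ioc (4 * pi y) (4 / ε), 8 / ENNReal.ofReal (u * profile pi P u ^ 2))
      ≤ ENNReal.ofReal (2 * T)) :
    (∑ z, pi z * (heat P T z y / pi y) = 1) ∧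
    ∑ z, pi z * (heat P T z y / pi y) ^ 2 - 1 ≤ ε := by
  have hy := hpipos y
  set g : ℝ → V → ℝ := fun t z => heat P t z y / pi y with hg
  have hgd : ∀ t z, HasDerivAt (fun s => g s z) (∑ w, (P - 1) z w * g t w) t := by
    intro t z
    have := (heat_deriv P t z y).div_const (pi y)
    rw [Finset.sum_div] at this
    simpa only [hg, mul_div_assoc] using this
  have hg0 : ∀ z, g 0 z = if z = y then 1 / pi y else 0 := by
    intro z
    simp only [hg, heat_zero, Matrix.one_apply]
    split_ifs <;> simp
  have hmean : ∀ t, ∑ z, pi z * g t z = 1 := by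
    have hd : ∀ t, HasDerivAt (fun s => ∑ z, pi z * g s z) 0 t := by
      intro t
      have := HasDerivAt.fun_sum (u := Finset.univ) (fun z _ => (hgd t z).const_mul (pi z))
      refine this.congr_deriv ?_
      have e : ∀ x, ∑ y, (P - 1) x y * g t y = (∑ y, P x y * g t y) - g t x := by
        intro x
        simp [Matrix.sub_apply, sub_mul, Finset.sum_sub_distrib, Matrix.one_apply]
      simp_rw [e, mul_sub, Finset.sum_sub_distrib, Finset.mul_sum, ← mul_assoc]
      rw [sum_snd P pi hstat, sub_self]
    intro t
    have h := is_const_of_deriv_eq_zero (f := fun s => ∑ z, pi z * g s z)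
      (fun t => (hd t).differentiableAt) (fun t => (hd t).deriv) t 0
    rw [h]
    simp [hg0, hy.ne']
  refine ⟨hmean T, ?_⟩
  set u : ℝ → ℝ := fun t => ∑ z, pi z * g t z ^ 2 - 1 with hu
  have hud : ∀ t, HasDerivAt u (-Dir pi P (g t)) t := by
    intro t
    have := (HasDerivAt.fun_sum (u := Finset.univ)
      (fun z _ => ((hgd t z).pow 2).const_mul (pi z))).sub_const 1
    refine this.congr_deriv ?_
    rw [Dir_eq P pi hp1 hstat, neg_neg]
    simp
  have hanti : Antitone u := antitone_of_hasDerivAt_nonpos hud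
    (fun t => neg_nonpos.mpr (Dir_nonneg P pi hp0 hpipos _))
  have hu0 : u 0 = 1 / pi y - 1 := by
    simp only [hu, hg0]
    simp
    field_simp
  change u T ≤ ε
  by_contra hlt
  push Not at hlt
  obtain ⟨T', hT'ε, hT'⟩ : ∃ T', ε < u T' ∧ T < T' := by
    have h1 : ∀ᶠ s in nhdsWithin T (Ioi T), ε < u s :=
      ((hud T).continuousAt.eventually (lt_mem_nhds hlt)).filter_mono nhdsWithin_le_nhds
    exact (h1.and self_mem_nhdsWithin).exists
  have hT'0 : 0 < T' := lt_of_le_of_lt hT hT'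
  have hlo : ∀ s ∈ Icc 0 T', ε < u s := fun s hs => lt_of_lt_of_le hT'ε (hanti hs.2)
  have hup : ∀ s ∈ Icc 0 T', u s ≤ 1 / pi y - 1 := fun s hs => hu0 ▸ hanti hs.1
  have hex : ∃ z, pi z ≤ 1 / 2 := by
    have h1 : 0 < 1 / pi y - 1 := lt_of_lt_of_le (hε.trans hT'ε) (hup T' ⟨hT'0.le, le_rfl⟩)
    have h2 : pi y < 1 := by
      rw [sub_pos, lt_div_iff₀ hy] at h1; linarith
    by_contra hcon
    push Not at hcon
    have h3 : ∑ z ∈ Finset.univ.erase y, pi z = 1 - pi y := by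
      rw [← hpi1, ← Finset.add_sum_erase _ _ (Finset.mem_univ y)]; ring
    have h4 : (Finset.univ.erase y).Nonempty := by
      by_contra hne
      rw [Finset.not_nonempty_iff_eq_empty] at hne
      rw [hne, Finset.sum_empty] at h3
      linarith
    obtain ⟨z, hz⟩ := h4
    have h5 := Finset.single_le_sum (f := pi) (fun i _ => (hpipos i).le) hz
    linarith [hcon z, hcon y]
  set w : ℝ → ℝ := fun s => 4 / u s with hw
  have hw1 : ∀ s ∈ Icc 0 T', 4 * pi y < w s := by
    intro s hs
    have hp := hε.trans (hlo s hs)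
    simp only [hw]
    rw [lt_div_iff₀ hp]
    have : pi y * u s ≤ pi y * (1 / pi y - 1) := mul_le_mul_of_nonneg_left (hup s hs) hy.le
    have e : pi y * (1 / pi y - 1) = 1 - pi y := by field_simp
    nlinarith
  have hw2 : ∀ s ∈ Icc 0 T', w s ≤ 4 / ε := fun s hs =>
    div_le_div_of_nonneg_left (by norm_num) hε (hlo s hs).le
  have hφ : ∀ s ∈ Icc 0 T', 0 < profile pi P (w s) := fun s hs =>
    hpos hex _ (by linarith [hw1 s hs])
  have hkey : ∀ s ∈ Icc 0 T', profile pi P (w s) ^ 2 * (u s / 2) ≤ Dir pi P (g s) := fun s hs =>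
    key P pi hp0 hp1 hstat hpipos hpi1 (g s)
      (fun z => div_nonneg (heat_nonneg P hp0 s hs.1 z y) hy.le) (hmean s) (u s) rfl
      (hε.trans (hlo s hs))
  have hstrict : StrictAntiOn u (Icc 0 T') := by
    refine strictAntiOn_of_deriv_neg (convex_Icc _ _)
      (fun s _ => (hud s).continuousAt.continuousWithinAt) fun s hs => ?_
    have hs' := interior_subset hs
    rw [(hud s).deriv, neg_lt_zero]
    refine lt_of_lt_of_le ?_ (hkey s hs')
    have := hφ s hs'
    have := hε.trans (hlo s hs')
    positivity
  have hinj : InjOn w (Icc 0 T') := by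
    intro a ha b hb hab
    refine hstrict.injOn ha hb ?_
    have h1 := (hε.trans (hlo a ha)).ne'
    have h2 := (hε.trans (hlo b hb)).ne'
    simp only [hw] at hab
    field_simp at hab
    linarith
  have hwd : ∀ s ∈ Icc 0 T', HasDerivWithinAt w (4 * Dir pi P (g s) / u s ^ 2) (Icc 0 T') s := by
    intro s hs
    have h1 := (hε.trans (hlo s hs)).ne'
    have := (HasDerivAt.fun_div (hasDerivAt_const s (4 : ℝ)) (hud s) h1).hasDerivWithinAt
      (s := Icc 0 T')
    refine this.congr_deriv ?_
    ring
  have hcv := lintegral_image_eq_lintegral_abs_deriv_mul measurableSet_Icc hwd hinj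
    (fun u => 8 / ENNReal.ofReal (u * profile pi P u ^ 2))
  have hsub : w '' Icc 0 T' ⊆ Ioc (4 * pi y) (4 / ε) := by
    rintro _ ⟨s, hs, rfl⟩
    exact ⟨hw1 s hs, hw2 s hs⟩
  have hle := (lintegral_mono_set (μ := volume)
    (f := fun u => 8 / ENNReal.ofReal (u * profile pi P u ^ 2)) hsub).trans hI
  rw [hcv] at hle
  have hge : ∫⁻ _ in Icc 0 T', (4 : ℝ≥0∞) ≤ ∫⁻ s in Icc 0 T',
      ENNReal.ofReal (|4 * Dir pi P (g s) / u s ^ 2|) *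
        (8 / ENNReal.ofReal (w s * profile pi P (w s) ^ 2)) := by
    refine setLIntegral_mono' measurableSet_Icc fun s hs => ?_
    have h1 := hε.trans (hlo s hs)
    have h2 := hφ s hs
    have h3 := hkey s hs
    have hwpos : 0 < w s := by simp only [hw]; positivity
    set a := w s * profile pi P (w s) ^ 2 with ha
    have ha0 : 0 < a := by positivity
    have h4 : a / 2 ≤ |4 * Dir pi P (g s) / u s ^ 2| := by
      refine le_trans ?_ (le_abs_self _)
      rw [le_div_iff₀ (by positivity)]
      have : a * u s = 4 * profile pi P (w s) ^ 2 := by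
        rw [ha]; simp only [hw]; field_simp
      nlinarith
    calc (4 : ℝ≥0∞) = ENNReal.ofReal (a / 2) * (8 / ENNReal.ofReal a) := by
          rw [show (8 : ℝ≥0∞) = ENNReal.ofReal 8 by simp, ← ENNReal.ofReal_div_of_pos ha0,
            ← ENNReal.ofReal_mul (by positivity),
            show a / 2 * (8 / a) = 4 by field_simp; norm_num]
          simp
      _ ≤ _ := by gcongr
  have hfin := hge.trans hle
  rw [setLIntegral_const, Real.volume_Icc, sub_zero,
    show (4 : ℝ≥0∞) = ENNReal.ofReal 4 by simp, ← ENNReal.ofReal_mul (by norm_num),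
    ENNReal.ofReal_le_ofReal_iff (by positivity)] at hfin
  linarith

/-- Time reversal. -/
noncomputable def rev (pi : V → ℝ) (P : Matrix V V ℝ) : Matrix V V ℝ :=
  fun z x => pi x * P x z / pi z

lemma rev_pow (P : Matrix V V ℝ) (pi : V → ℝ) (hpipos : ∀ x, 0 < pi x) (k : ℕ) (z x : V) :
    ((rev pi P - 1) ^ k) z x = pi x / pi z * ((P - 1) ^ k) x z := by
  induction k generalizing z x with
  | zero =>
    rw [pow_zero, pow_zero, Matrix.one_apply, Matrix.one_apply]
    by_cases h : z = x
    · subst h; simp [(hpipos z).ne']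
    · simp [h, Ne.symm h]
  | succ k ih =>
    rw [pow_succ, pow_succ', Matrix.mul_apply, Matrix.mul_apply, Finset.mul_sum]
    refine Finset.sum_congr rfl fun w _ => ?_
    have e : (rev pi P - 1) w x = pi x / pi w * (P - 1) x w := by
      simp only [Matrix.sub_apply, Matrix.one_apply, rev]
      by_cases h : w = x
      · subst h; have := (hpipos w).ne'; simp; field_simp
      · simp [h, Ne.symm h]; ring
    rw [ih, e]
    have := (hpipos w).ne'
    have := (hpipos z).ne'
    field_simp

lemma heat_rev (P : Matrix V V ℝ) (pi : V → ℝ) (hpipos : ∀ x, 0 < pi x) (t : ℝ) (z x : V) :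
    heat (rev pi P) t z x = pi x / pi z * heat P t x z := by
  unfold heat
  rw [← tsum_mul_left]
  refine tsum_congr fun k => ?_
  rw [rev_pow P pi hpipos]; ring

lemma cond_rev (P : Matrix V V ℝ) (pi : V → ℝ) (hpipos : ∀ x, 0 < pi x)
    (hp1 : ∀ x, ∑ y, P x y = 1) (hstat : ∀ y, ∑ x, pi x * P x y = pi y) (S : Set V) :
    cond pi (rev pi P) S = cond pi P S := by
  unfold cond
  congr 1
  have h1 := sum_fst P pi hp1 (fun x => if x ∈ S then 1 else 0)
  have h2 := sum_snd P pi hstat (fun x => if x ∈ S then 1 else 0)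
  have h3 : Qset pi P S Sᶜ - Qset pi (rev pi P) S Sᶜ = 
      ∑ x, ∑ y, pi x * P x y * (if x ∈ S then 1 else 0) -
      ∑ x, ∑ y, pi x * P x y * (if y ∈ S then 1 else 0) := by
    have hq : Qset pi (rev pi P) S Sᶜ =
        ∑ x, ∑ y, if y ∈ S ∧ x ∈ Sᶜ then pi y * rev pi P y x else 0 := by
      rw [Qset_eq, Finset.sum_comm]
      refine Finset.sum_congr rfl fun x _ => Finset.sum_congr rfl fun y _ => ?_
      congr
    rw [hq, Qset_eq,
      ← Finset.sum_sub_distrib, ← Finset.sum_sub_distrib]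
    refine Finset.sum_congr rfl fun x _ => ?_
    rw [← Finset.sum_sub_distrib, ← Finset.sum_sub_distrib]
    refine Finset.sum_congr rfl fun y _ => ?_
    have := (hpipos y).ne'
    by_cases hx : x ∈ S <;> by_cases hy : y ∈ S <;> simp [hx, hy, rev]
    field_simp
  rw [h1, h2, sub_self] at h3
  linarith

/-- Theorem (cont1): uniform mixing bound for the continuous-time chain
`h_t = e^{t(P-I)}` from the conductance profile of `P`. -/
theorem cont_uniform_mixing_from_conductance [Nonempty V]
    (P : Matrix V V ℝ) (pi : V → ℝ)
    (hp0 : ∀ x y, 0 ≤ P x y) (hp1 : ∀ x, ∑ y, P x y = 1)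
    (hpipos : ∀ x, 0 < pi x) (hpi1 : ∑ x, pi x = 1)
    (hstat : ∀ y, ∑ x, pi x * P x y = pi y)
    (hirr : ∀ x y : V, ∃ n : ℕ, 0 < (P ^ n) x y)
    (ε : ℝ) (hε : 0 < ε) :
    (∀ (x y : V) (t : ℝ), 0 ≤ t →
        (∫⁻ u in Ioc (4 * min (pi x) (pi y)) (4 / ε),
            8 / ENNReal.ofReal (u * profile pi P u ^ 2)) ≤ ENNReal.ofReal t →
        |heat P t x y / pi y - 1| ≤ ε) ∧
      ENNReal.ofReal
          (sInf {t : ℝ | 0 ≤ t ∧ ∀ x y : V, |heat P t x y / pi y - 1| ≤ ε}) ≤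
        ∫⁻ u in Ioc (4 * sInf (range pi)) (4 / ε),
          8 / ENNReal.ofReal (u * profile pi P u ^ 2) := by
  have main : ∀ (x y : V) (t : ℝ), 0 ≤ t →
        (∫⁻ u in Ioc (4 * min (pi x) (pi y)) (4 / ε),
            8 / ENNReal.ofReal (u * profile pi P u ^ 2)) ≤ ENNReal.ofReal t →
        |heat P t x y / pi y - 1| ≤ ε := by
    intro x y t ht hI
    have hprof : profile pi (rev pi P) = profile pi P := by
      have : cond pi (rev pi P) = cond pi P :=
        funext fun S => cond_rev P pi hpipos hp1 hstat S
      unfold profile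
      rw [this]
    have hIy := (lintegral_mono_set (μ := volume)
      (f := fun u => 8 / ENNReal.ofReal (u * profile pi P u ^ 2))
      (Ioc_subset_Ioc_left (b := 4 / ε) (mul_le_mul_of_nonneg_left (min_le_right (pi x) (pi y))
        (by norm_num : (0:ℝ) ≤ 4)))).trans hI
    have hIx := (lintegral_mono_set (μ := volume)
      (f := fun u => 8 / ENNReal.ofReal (u * profile pi P u ^ 2))
      (Ioc_subset_Ioc_left (b := 4 / ε) (mul_le_mul_of_nonneg_left (min_le_left (pi x) (pi y))
        (by norm_num : (0:ℝ) ≤ 4)))).trans hI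
    obtain ⟨a1, a2⟩ := decay P pi hp0 hp1 hstat hpipos hpi1 y
      (fun h r hr => profile_pos P pi hp0 hpipos hpi1 hirr h y r hr) ε hε (t / 2) (by positivity)
      (by rw [mul_div_cancel₀ t two_ne_zero]; exact hIy)
    obtain ⟨b1, b2⟩ := decay (rev pi P) pi
      (fun z x => div_nonneg (mul_nonneg (hpipos x).le (hp0 x z)) (hpipos z).le)
      (fun z => by
        simp only [rev]
        rw [← Finset.sum_div, hstat, div_self (hpipos z).ne'])
      (fun x => by
        have : ∀ z, pi z * rev pi P z x = pi x * P x z := by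
          intro z
          have := (hpipos z).ne'
          simp only [rev]; field_simp
        simp_rw [this]
        rw [← Finset.mul_sum, hp1, mul_one])
      hpipos hpi1 x
      (fun h r hr => by
        rw [hprof]; exact profile_pos P pi hp0 hpipos hpi1 hirr h x r hr) ε hε (t / 2)
      (by positivity)
      (by rw [mul_div_cancel₀ t two_ne_zero, hprof]; exact hIx)
    set F : V → ℝ := fun z => heat (rev pi P) (t / 2) z x / pi x with hF
    set G : V → ℝ := fun z => heat P (t / 2) z y / pi y with hG
    have hFG : heat P t x y / pi y = ∑ z, pi z * (F z * G z) := by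
      have : heat P t = heat P (t / 2) * heat P (t / 2) := by
        rw [← heat_add]; congr 1; ring
      rw [this, Matrix.mul_apply, Finset.sum_div]
      refine Finset.sum_congr rfl fun z _ => ?_
      simp only [hF, hG]
      rw [heat_rev P pi hpipos]
      have := (hpipos z).ne'
      have := (hpipos x).ne'
      field_simp
    have hc : heat P t x y / pi y - 1 = ∑ z, pi z * ((F z - 1) * (G z - 1)) := by
      have : ∑ z, pi z * ((F z - 1) * (G z - 1)) = ∑ z, pi z * (F z * G z) - ∑ z, pi z * F z
          - ∑ z, pi z * G z + ∑ z, pi z := by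
        rw [← Finset.sum_sub_distrib, ← Finset.sum_sub_distrib, ← Finset.sum_add_distrib]
        exact Finset.sum_congr rfl fun z _ => by ring
      rw [this, a1, b1, hpi1, hFG]; ring
    have hv : ∀ K : V → ℝ, ∑ z, pi z * K z = 1 → ∑ z, pi z * K z ^ 2 - 1 ≤ ε →
        ∑ z, pi z * (K z - 1) ^ 2 ≤ ε := by
      intro K h1 h2
      have : ∑ z, pi z * (K z - 1) ^ 2 = ∑ z, pi z * K z ^ 2 - 2 * ∑ z, pi z * K z
          + ∑ z, pi z := by
        rw [Finset.mul_sum, ← Finset.sum_sub_distrib, ← Finset.sum_add_distrib]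
        exact Finset.sum_congr rfl fun z _ => by ring
      rw [this, h1, hpi1]; linarith
    have c1 := hv F b1 b2
    have c2 := hv G a1 a2
    rw [hc]
    refine (Finset.abs_sum_le_sum_abs _ _).trans ?_
    have : ∑ z, |pi z * ((F z - 1) * (G z - 1))| ≤
        1 / 2 * (∑ z, pi z * (F z - 1) ^ 2 + ∑ z, pi z * (G z - 1) ^ 2) := by
      rw [← Finset.sum_add_distrib, Finset.mul_sum]
      refine Finset.sum_le_sum fun z _ => ?_
      rw [abs_mul, abs_of_pos (hpipos z), ← mul_add, mul_left_comm]
      refine mul_le_mul_of_nonneg_left ?_ (hpipos z).le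
      rw [abs_le]
      constructor <;> nlinarith [sq_nonneg (F z - 1 + (G z - 1)), sq_nonneg (F z - 1 - (G z - 1))]
    linarith
  refine ⟨main, ?_⟩
  set I := ∫⁻ u in Ioc (4 * sInf (range pi)) (4 / ε),
          8 / ENNReal.ofReal (u * profile pi P u ^ 2) with hI
  by_cases hIt : I = ⊤
  · rw [hIt]; exact le_top
  · rw [← ENNReal.ofReal_toReal hIt]
    refine ENNReal.ofReal_le_ofReal (csInf_le ⟨0, fun t ht => ht.1⟩ ⟨ENNReal.toReal_nonneg, ?_⟩)
    intro x y
    refine main x y _ ENNReal.toReal_nonneg ?_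
    rw [ENNReal.ofReal_toReal hIt, hI]
    have hb : BddBelow (range pi) := (Set.toFinite _).bddBelow
    refine lintegral_mono_set (Ioc_subset_Ioc_left (mul_le_mul_of_nonneg_left ?_ (by norm_num)))
    exact le_min (csInf_le hb ⟨x, rfl⟩) (csInf_le hb ⟨y, rfl⟩)

end ContTimePaper
end

section
/- Suppose p(x,x) ≥ 1/2 for all x ∈ V. Then for every S ⊆ V with 0 < π(S) ≤ 1/2 and θ_S > 0, one has ψ(S) ≥ θ_S²/(8 log(2/θ_S²)), where θ_S = (1/π(S)) Σ_{y∈S} √(π(y) Q(S^c,y)). -/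
open MeasureTheory Set
open scoped ENNReal Classical

namespace EvolvingSetsPaper

variable {V : Type*}

/-- `π(S) = ∑_{y ∈ S} π(y)`. -/
noncomputable def piS (pi : V → ℝ) (S : Set V) : ℝ := ∑' y : S, pi y

/-- `Q(S, y) = ∑_{s ∈ S} π(s) p(s, y)`. -/
noncomputable def QS (pi : V → ℝ) (p : V → V → ℝ) (S : Set V) (y : V) : ℝ :=
  ∑' s : S, pi s * p s y

/-- `Q(S, A) = ∑_{s ∈ S, a ∈ A} π(s) p(s, a)`. -/
noncomputable def Qset (pi : V → ℝ) (p : V → V → ℝ) (S A : Set V) : ℝ :=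
  ∑' a : A, QS pi p S a

/-- The conductance `Φ_S = Q(S, Sᶜ)/π(S)`. -/
noncomputable def cond (pi : V → ℝ) (p : V → V → ℝ) (S : Set V) : ℝ :=
  Qset pi p S Sᶜ / piS pi S

/-- The conductance profile `Φ(r)`, constant for `r > 1/2`. -/
noncomputable def profile (pi : V → ℝ) (p : V → V → ℝ) (r : ℝ) : ℝ :=
  if r ≤ 1 / 2 then sInf (cond pi p '' {S : Set V | 0 < piS pi S ∧ piS pi S ≤ r})
  else sInf (cond pi p '' {S : Set V | 0 < piS pi S ∧ piS pi S ≤ 1 / 2})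

/-- `n`-step transition probabilities. -/
noncomputable def pn (p : V → V → ℝ) : ℕ → V → V → ℝ
  | 0 => fun x y => if x = y then 1 else 0
  | n + 1 => fun x y => ∑' z, pn p n x z * p z y

/-- One step of the evolving set process with uniform value `u`:
`S̃ = {y : Q(S,y) ≥ u π(y)}`. -/
def esStep (pi : V → ℝ) (p : V → V → ℝ) (S : Set V) (u : ℝ) : Set V :=
  {y | u * pi y ≤ QS pi p S y}

/-- `esE pi p n F S = E_S[F(S_n)]` for the evolving set process started at `S`,
driven by i.i.d. uniform variables on `[0,1]`. -/
noncomputable def esE (pi : V → ℝ) (p : V → V → ℝ) : ℕ → (Set V → ℝ) → Set V → ℝ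
  | 0 => fun F S => F S
  | n + 1 => fun F S => ∫ u in (0:ℝ)..1, esE pi p n F (esStep pi p S u)

/-- `ψ(S) = 1 - E_S √(π(S̃)/π(S))`. -/
noncomputable def psiSet (pi : V → ℝ) (p : V → V → ℝ) (S : Set V) : ℝ :=
  1 - ∫ u in (0:ℝ)..1, Real.sqrt (piS pi (esStep pi p S u) / piS pi S)

/-- The root profile `ψ(r)`, constant for `r > 1/2`. -/
noncomputable def rootProfile (pi : V → ℝ) (p : V → V → ℝ) (r : ℝ) : ℝ :=
  if r ≤ 1 / 2 then sInf (psiSet pi p '' {S : Set V | 0 < piS pi S ∧ piS pi S ≤ r})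
  else sInf (psiSet pi p '' {S : Set V | 0 < piS pi S ∧ piS pi S ≤ 1 / 2})

/-- `φ_S = (1/(2π(S))) ∑_y min(Q(S,y), Q(Sᶜ,y))`. -/
noncomputable def phiS (pi : V → ℝ) (p : V → V → ℝ) (S : Set V) : ℝ :=
  (1 / (2 * piS pi S)) * ∑' y, min (QS pi p S y) (QS pi p Sᶜ y)

/-- `S^♯ = S` if `π(S) ≤ 1/2`, else `Sᶜ`. -/
noncomputable def sharp (pi : V → ℝ) (S : Set V) : Set V :=
  if piS pi S ≤ 1 / 2 then S else Sᶜ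

/-- `χ²(μ, π) = ∑_y π(y) (μ(y)/π(y) - 1)²`. -/
noncomputable def chiSq (pi : V → ℝ) (mu : V → ℝ) : ℝ :=
  ∑' y, pi y * (mu y / pi y - 1) ^ 2


/-- `θ_S = (1/π(S)) ∑_{y ∈ S} √(π(y) Q(Sᶜ, y))`. -/
noncomputable def thetaS (pi : V → ℝ) (p : V → V → ℝ) (S : Set V) : ℝ :=
  (1 / piS pi S) * ∑' y : S, Real.sqrt (pi y * QS pi p Sᶜ y)

/-- kernel used for the test function. -/
noncomputable def kk (u : ℝ) : ℝ := 1 / (2 * Real.sqrt (1 - u))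

/-- truncated test function. -/
noncomputable def ph (e : ℝ) (u : ℝ) : ℝ := (Ioc (1/2 : ℝ) (1 - e)).indicator kk u

lemma kk_meas : Measurable kk := by unfold kk; fun_prop

lemma kk_nonneg (u : ℝ) : 0 ≤ kk u := by unfold kk; positivity

lemma ph_meas (e : ℝ) : Measurable (ph e) := kk_meas.indicator measurableSet_Ioc

lemma ph_nonneg (e u : ℝ) : 0 ≤ ph e u := indicator_nonneg (fun u _ => kk_nonneg u) u

lemma ph_le (e : ℝ) (he : 0 < e) (u : ℝ) : ph e u ≤ 1 / (2 * Real.sqrt e) := by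
  unfold ph
  have hC : (0:ℝ) ≤ 1 / (2 * Real.sqrt e) := by positivity
  by_cases hu : u ∈ Ioc (1/2 : ℝ) (1 - e)
  swap
  · rw [indicator_of_notMem hu]; exact hC
  rw [indicator_of_mem hu]
  unfold kk
  have : Real.sqrt e ≤ Real.sqrt (1 - u) := Real.sqrt_le_sqrt (by linarith [hu.2])
  have h0 : 0 < Real.sqrt e := Real.sqrt_pos.2 he
  gcongr

lemma int_kk (b : ℝ) (hb : 1 / 2 ≤ b) (hb1 : b < 1) :
    ∫ u in (1/2 : ℝ)..b, kk u = Real.sqrt (1/2) - Real.sqrt (1 - b) := by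
  have hc : ContinuousOn kk (uIcc (1/2 : ℝ) b) := by
    rw [uIcc_of_le hb]
    unfold kk
    refine continuousOn_const.div (by fun_prop) (fun u hu => ?_)
    have : 0 < Real.sqrt (1 - u) := Real.sqrt_pos.2 (by linarith [hu.2])
    positivity
  rw [intervalIntegral.integral_eq_sub_of_hasDerivAt (f := fun u => - Real.sqrt (1 - u))
    _ hc.intervalIntegrable]
  · norm_num; ring
  · intro u hu
    rw [uIcc_of_le hb] at hu
    have h1 : HasDerivAt (fun u : ℝ => 1 - u) (-1) u := by
      simpa using (hasDerivAt_id u).const_sub 1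
    have h2 := (h1.sqrt (by linarith [hu.2])).fun_neg
    refine h2.congr_deriv ?_
    unfold kk
    ring

lemma int_kk2 (b : ℝ) (hb : 1 / 2 ≤ b) (hb1 : b < 1) :
    ∫ u in (1/2 : ℝ)..b, kk u ^ 2 = (Real.log (1/2) - Real.log (1 - b)) / 4 := by
  have hc : ContinuousOn (fun u => kk u ^ 2) (uIcc (1/2 : ℝ) b) := by
    rw [uIcc_of_le hb]
    unfold kk
    refine ContinuousOn.pow (continuousOn_const.div (by fun_prop) (fun u hu => ?_)) 2
    have : 0 < Real.sqrt (1 - u) := Real.sqrt_pos.2 (by linarith [hu.2])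
    positivity
  rw [intervalIntegral.integral_eq_sub_of_hasDerivAt (f := fun u => - (Real.log (1 - u)) / 4)
    _ hc.intervalIntegrable]
  · norm_num; ring
  · intro u hu
    rw [uIcc_of_le hb] at hu
    have h1 : HasDerivAt (fun u : ℝ => 1 - u) (-1) u := by
      simpa using (hasDerivAt_id u).const_sub 1
    have hne : 1 - u ≠ 0 := by linarith [hu.2]
    have h2 := ((h1.log hne).fun_neg).div_const 4
    refine h2.congr_deriv ?_
    unfold kk
    rw [div_pow, mul_pow, Real.sq_sqrt (by linarith [hu.2])]
    field_simp
    norm_num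

/-- integral of an indicator of a subinterval of `(0,1]`. -/
lemma int_ind (f : ℝ → ℝ) (b : ℝ) (hb : 1 / 2 ≤ b) (hb1 : b < 1) :
    ∫ u in Ioc (0:ℝ) 1, (Ioc (1/2 : ℝ) b).indicator f u = ∫ u in (1/2 : ℝ)..b, f u := by
  rw [intervalIntegral.integral_of_le hb, setIntegral_indicator measurableSet_Ioc]
  congr 2
  ext u
  simp only [mem_inter_iff, mem_Ioc]
  constructor
  · exact fun h => h.2
  · intro h
    exact ⟨⟨by linarith [h.1], by linarith [h.2]⟩, h⟩

lemma key_pt (g x : ℝ) (hg : 0 ≤ g) (hx : x = 0 ∨ g ≤ 1) :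
    Real.sqrt g ≤ (1 + g) / 2 - x * (1 - g) / 4 + x ^ 2 / 8 := by
  obtain ⟨s, hs, rfl⟩ : ∃ s, 0 ≤ s ∧ g = s ^ 2 :=
    ⟨Real.sqrt g, Real.sqrt_nonneg _, (Real.sq_sqrt hg).symm⟩
  rw [Real.sqrt_sq hs]
  rcases hx with rfl | h
  · nlinarith [sq_nonneg (s - 1)]
  · have h1 : s ≤ 1 := by nlinarith
    have h2 : (1 - s ^ 2) ^ 2 ≤ 4 * (1 - s) ^ 2 := by
      have : (1 - s ^ 2) ^ 2 = (1 - s) ^ 2 * (1 + s) ^ 2 := by ring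
      rw [this]
      nlinarith [sq_nonneg (1 - s)]
    nlinarith [sq_nonneg (x - (1 - s ^ 2))]

/-- Fubini for the layer-cake sum. -/
lemma layer (pi a : V → ℝ) [Countable V] (hpipos : ∀ x, 0 < pi x) (hs : Summable pi)
    (r : ℝ → ℝ) (hr : Measurable r) (hr0 : ∀ u, 0 ≤ r u) (C : ℝ) (hC : ∀ u, r u ≤ C) :
    HasSum (fun y => pi y * ∫ u in Ioc (0:ℝ) 1, (Iic (a y)).indicator r u)
      (∫ u in Ioc (0:ℝ) 1, r u * ∑' y, {y | u ≤ a y}.indicator pi y) := by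
  have hI : ∀ y, Integrable ((Iic (a y)).indicator r) (volume.restrict (Ioc (0:ℝ) 1)) := by
    intro y
    refine Integrable.of_bound (C := C) (hr.indicator measurableSet_Iic).aestronglyMeasurable ?_
    refine Filter.Eventually.of_forall (fun u => ?_)
    rw [Real.norm_of_nonneg (indicator_nonneg (fun u _ => hr0 u) u)]
    exact (indicator_le_self' (fun u _ => hr0 u) u).trans (hC u)
  have h := hasSum_integral_of_summable_integral_norm
    (μ := volume.restrict (Ioc (0:ℝ) 1))
    (F := fun y u => pi y * (Iic (a y)).indicator r u) (fun y => (hI y).const_mul _) ?_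
  · have e1 : ∀ u, r u * ∑' y, {y | u ≤ a y}.indicator pi y
        = ∑' y, pi y * (Iic (a y)).indicator r u := by
      intro u
      rw [← tsum_mul_left]
      congr 1
      funext y
      by_cases hy : u ≤ a y
      · simp [indicator, hy, mul_comm]
      · simp [indicator, hy]
    simp only [e1]
    simp only [integral_const_mul] at h
    exact h
  · refine Summable.of_nonneg_of_le (fun y => integral_nonneg (fun u => norm_nonneg _)) (fun y => ?_)
      (hs.mul_right C)
    have : ∫ u in Ioc (0:ℝ) 1, ‖pi y * (Iic (a y)).indicator r u‖
        ≤ ∫ u in Ioc (0:ℝ) 1, pi y * C := by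
      refine integral_mono_of_nonneg (Filter.Eventually.of_forall (fun u => norm_nonneg _))
        (integrable_const _) (Filter.Eventually.of_forall (fun u => ?_))
      have h0 := indicator_nonneg (s := Iic (a y)) (fun u _ => hr0 u) u
      simp only
      rw [Real.norm_of_nonneg (mul_nonneg (hpipos y).le h0)]
      exact mul_le_mul_of_nonneg_left
        ((indicator_le_self' (fun u _ => hr0 u) u).trans (hC u)) (hpipos y).le
    simpa using this

lemma summable_of_tsum_ne {ι : Type*} (f : ι → ℝ) (h : ∑' i, f i ≠ 0) : Summable f := by
  by_contra hc
  exact h (tsum_eq_zero_of_not_summable hc)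

lemma QS_sum (p : V → V → ℝ) (pi : V → ℝ)
    (hp0 : ∀ x y, 0 ≤ p x y) (hp1 : ∀ x, ∑' y, p x y = 1)
    (hpipos : ∀ x, 0 < pi x) (hpi1 : ∑' x, pi x = 1) (S : Set V) :
    HasSum (fun y => QS pi p S y) (piS pi S) := by
  have hsp : Summable pi := summable_of_tsum_ne _ (by rw [hpi1]; norm_num)
  have hsr : ∀ x, Summable (p x) := fun x => summable_of_tsum_ne _ (by rw [hp1]; norm_num)
  have hsum : Summable (fun z : S × V => pi z.1 * p z.1 z.2) := by
    rw [summable_prod_of_nonneg (fun z : S × V => mul_nonneg (hpipos z.1).le (hp0 z.1 z.2))]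
    refine ⟨fun x => Summable.mul_left (pi x) (f := p x) (hsr x), ?_⟩
    simp only [tsum_mul_left, hp1, mul_one]
    exact hsp.subtype S
  have hsw : Summable (fun z : V × S => pi z.2 * p z.2 z.1) :=
    (Equiv.prodComm V S).summable_iff.2 hsum
  have h1 := hsw.prod.hasSum
  have h2 : ∑' y : V, ∑' s : S, pi s * p s y = piS pi S := by
    have := Summable.tsum_comm (f := fun (s : S) (y : V) => pi s * p s y) hsum
    rw [this]
    simp only [tsum_mul_left, hp1, mul_one]
    rfl
  rw [← h2]
  exact h1

/-- Theorem (concluding remark 3): under laziness `p(x,x) ≥ 1/2`,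
`ψ(S) ≥ θ_S² / (8 log(2/θ_S²))`. -/
theorem psiSet_ge_thetaS [Countable V]
    (p : V → V → ℝ) (pi : V → ℝ)
    (hp0 : ∀ x y, 0 ≤ p x y) (hp1 : ∀ x, ∑' y, p x y = 1)
    (hpipos : ∀ x, 0 < pi x) (hpi1 : ∑' x, pi x = 1)
    (hstat : ∀ y, ∑' x, pi x * p x y = pi y)
    (hirr : ∀ x y : V, ∃ n, 0 < pn p n x y)
    (hlazy : ∀ x, (1 : ℝ) / 2 ≤ p x x)
    (S : Set V) (hS0 : 0 < piS pi S) (hS1 : piS pi S ≤ 1 / 2)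
    (hθ : 0 < thetaS pi p S) :
    thetaS pi p S ^ 2 / (8 * Real.log (2 / thetaS pi p S ^ 2)) ≤ psiSet pi p S := by
  have hsp : Summable pi := summable_of_tsum_ne _ (by rw [hpi1]; norm_num)
  have hsc : ∀ y, Summable (fun x => pi x * p x y) := fun y =>
    summable_of_tsum_ne _ (by rw [hstat]; exact (hpipos y).ne')
  have hQ0 : ∀ T y, 0 ≤ QS pi p T y := fun T y =>
    tsum_nonneg (fun s => mul_nonneg (hpipos _).le (hp0 _ _))
  have hQadd : ∀ y, QS pi p S y + QS pi p Sᶜ y = pi y := by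
    intro y
    rw [← hstat y]
    exact Summable.tsum_add_tsum_compl ((hsc y).subtype _) ((hsc y).subtype _)
  have hQdiag : ∀ (T : Set V) y, y ∈ T → pi y / 2 ≤ QS pi p T y := by
    intro T y hy
    have h := Summable.le_tsum ((hsc y).subtype T) ⟨y, hy⟩
      (fun s _ => mul_nonneg (hpipos _).le (hp0 _ _))
    have h' : pi y * p y y ≤ QS pi p T y := h
    nlinarith [hlazy y, hpipos y]
  set θ := thetaS pi p S with hθdef
  set P := piS pi S with hP
  set a : V → ℝ := fun y => QS pi p S y / pi y with ha
  have hes : ∀ u, esStep pi p S u = {y | u ≤ a y} := by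
    intro u
    ext y
    simp only [esStep, mem_ofPred_eq, ha]
    rw [le_div_iff₀ (hpipos y)]
  have hPi : ∀ T : Set V, piS pi T = ∑' y, T.indicator pi y := fun T => tsum_subtype T pi
  have haS : ∀ y ∈ S, 1 / 2 ≤ a y := by
    intro y hy
    rw [ha]
    simp only
    rw [le_div_iff₀ (hpipos y)]
    linarith [hQdiag S y hy]
  have haSc : ∀ y, y ∉ S → a y ≤ 1 / 2 := by
    intro y hy
    rw [ha]
    simp only
    rw [div_le_iff₀ (hpipos y)]
    linarith [hQdiag Sᶜ y hy, hQadd y]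
  have hsq : ∀ y, Real.sqrt (pi y * QS pi p Sᶜ y) = pi y * Real.sqrt (1 - a y) := by
    intro y
    have : pi y * QS pi p Sᶜ y = pi y ^ 2 * (1 - a y) := by
      have h := hQadd y
      have h' := (hpipos y).ne'
      simp only [ha]
      field_simp
      linarith
    rw [this, Real.sqrt_mul (sq_nonneg _), Real.sqrt_sq (hpipos y).le]
  have ha0 : ∀ y, 0 ≤ a y := fun y => div_nonneg (hQ0 S y) (hpipos y).le
  have hs1 : ∀ y, Real.sqrt (1 - a y) ≤ 1 := fun y => by
    rw [Real.sqrt_le_iff]; constructor <;> linarith [ha0 y]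
  have hsums : Summable (fun y => pi y * Real.sqrt (1 - a y)) :=
    Summable.of_nonneg_of_le (fun y => mul_nonneg (hpipos y).le (Real.sqrt_nonneg _))
      (fun y => mul_le_of_le_one_right (hpipos y).le (hs1 y)) hsp
  have hθP : HasSum (S.indicator (fun y => pi y * Real.sqrt (1 - a y))) (P * θ) := by
    have h1 : P * θ = ∑' y : S, pi y * Real.sqrt (1 - a y) := by
      rw [hθdef, thetaS]
      simp only [hsq]
      rw [← hP, ← mul_assoc, mul_one_div_cancel hS0.ne', one_mul]
    rw [h1, tsum_subtype S (fun y => pi y * Real.sqrt (1 - a y))]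
    exact (hsums.indicator S).hasSum
  have hPsum : HasSum (S.indicator pi) P := by
    rw [hP, hPi]
    exact (hsp.indicator S).hasSum
  have hθ1 : θ ≤ 1 := by
    have := hasSum_le (fun y => indicator_le_indicator (s := S)
      (f := fun y => pi y * Real.sqrt (1 - a y)) (g := pi) (a := y)
      (mul_le_of_le_one_right (hpipos y).le (hs1 y))) hθP hPsum
    nlinarith
  set e := θ ^ 2 / 4 with he
  have he0 : 0 < e := by positivity
  have he1 : 1 / 2 ≤ 1 - e := by rw [he]; nlinarith
  have hse : Real.sqrt e = θ / 2 := by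
    rw [he, show θ ^ 2 / 4 = (θ / 2) ^ 2 by ring, Real.sqrt_sq (by positivity)]
  set L := Real.log (2 / θ ^ 2) with hL
  have hL0 : 0 < L := by
    apply Real.log_pos
    rw [lt_div_iff₀ (by positivity)]
    nlinarith
  set μ := volume.restrict (Ioc (0:ℝ) 1) with hμ
  set G : ℝ → ℝ := fun u => ∑' y, {y | u ≤ a y}.indicator pi y with hG
  have hind : ∀ T : Set V, Summable (T.indicator pi) := fun T => hsp.indicator T
  have hG0 : ∀ u, 0 ≤ G u := fun u => tsum_nonneg (fun y => indicator_nonneg (fun y _ => (hpipos y).le) y)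
  have hG1 : ∀ u, G u ≤ 1 := fun u => by
    rw [← hpi1]
    exact Summable.tsum_le_tsum (fun y => indicator_le_self' (fun y _ => (hpipos y).le) y) (hind _) hsp
  have hGanti : Antitone G := by
    intro u v huv
    refine Summable.tsum_le_tsum (fun y => ?_) (hind _) (hind _)
    exact indicator_le_indicator_of_subset (fun y (hy : v ≤ a y) => huv.trans hy)
      (fun y => (hpipos y).le) y
  have hGm : Measurable G := hGanti.measurable
  have hGP : ∀ u, 1 / 2 < u → G u ≤ P := by
    intro u hu
    rw [← hPsum.tsum_eq]
    refine Summable.tsum_le_tsum (fun y => ?_) (hind _) (hind _)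
    refine indicator_le_indicator_of_subset (fun y (hy : u ≤ a y) => ?_) (fun y => (hpipos y).le) y
    by_contra hc
    linarith [haSc y hc]
  have hphi_bd := ph_le e he0
  set C := 1 / (2 * Real.sqrt e) with hCdef
  have hbint : ∀ (f : ℝ → ℝ) (K : ℝ), Measurable f → (∀ u, 0 ≤ f u) → (∀ u, f u ≤ K) →
      Integrable f μ := by
    intro f K hf h0 hK
    refine Integrable.of_bound (C := K) hf.aestronglyMeasurable (Filter.Eventually.of_forall ?_)
    intro u
    rw [Real.norm_of_nonneg (h0 u)]
    exact hK u
  have hiG : Integrable G μ := hbint G 1 hGm hG0 hG1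
  have hiph : Integrable (ph e) μ := hbint _ C (ph_meas e) (ph_nonneg e) hphi_bd
  have hC0 : 0 ≤ C := (ph_nonneg e 0).trans (hphi_bd 0)
  have hiphG : Integrable (fun u => ph e u * G u) μ :=
    hbint _ (C * 1) ((ph_meas e).mul hGm) (fun u => mul_nonneg (ph_nonneg e u) (hG0 u))
      (fun u => mul_le_mul (hphi_bd u) (hG1 u) (hG0 u) hC0)
  have hiph2 : Integrable (fun u => ph e u ^ 2) μ :=
    hbint _ (C ^ 2) ((ph_meas e).pow_const 2) (fun u => sq_nonneg _)
      (fun u => pow_le_pow_left₀ (ph_nonneg e u) (hphi_bd u) 2)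
  have I1 : ∫ u, G u ∂μ ≤ P := by
    have h := layer pi a hpipos hsp (fun _ => 1) measurable_const (fun _ => zero_le_one) 1
      (fun _ => le_rfl)
    simp only [one_mul] at h
    refine hasSum_le (fun y => ?_) h (QS_sum p pi hp0 hp1 hpipos hpi1 S)
    have h1 : ∫ u in Ioc (0:ℝ) 1, (Iic (a y)).indicator (fun _ => (1:ℝ)) u ≤ a y := by
      rw [setIntegral_indicator measurableSet_Iic, setIntegral_const]
      simp only [smul_eq_mul, mul_one]
      rw [Measure.real]
      apply ENNReal.toReal_le_of_le_ofReal (ha0 y)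
      calc volume (Ioc (0:ℝ) 1 ∩ Iic (a y)) ≤ volume (Ioc (0:ℝ) (a y)) :=
            measure_mono (fun u hu => ⟨hu.1.1, hu.2⟩)
        _ = ENNReal.ofReal (a y) := by rw [Real.volume_Ioc, sub_zero]
    calc _ ≤ pi y * a y := mul_le_mul_of_nonneg_left h1 (hpipos y).le
      _ = QS pi p S y := mul_div_cancel₀ _ (hpipos y).ne'
  have I2 : ∫ u, ph e u * G u ∂μ ≤ P * Real.sqrt (1/2) - P * θ := by
    have h := layer pi a hpipos hsp (ph e) (ph_meas e) (ph_nonneg e) C hphi_bd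
    refine hasSum_le (fun y => ?_) h ((hPsum.mul_right _).sub hθP)
    have h1 : (Iic (a y)).indicator (ph e) = (Ioc (1/2:ℝ) (min (1 - e) (a y))).indicator kk := by
      change (Iic (a y)).indicator ((Ioc (1/2 : ℝ) (1 - e)).indicator kk) = _
      rw [indicator_indicator]
      congr 1
      ext u
      simp only [mem_inter_iff, mem_Iic, mem_Ioc, le_min_iff]
      tauto
    rw [h1]
    by_cases hy : y ∈ S
    · rw [int_ind _ _ (le_min he1 (haS y hy)) ((min_le_left _ _).trans_lt (by linarith)),
        int_kk _ (le_min he1 (haS y hy)) ((min_le_left _ _).trans_lt (by linarith))]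
      simp only [indicator_of_mem hy]
      rw [← mul_sub]
      refine mul_le_mul_of_nonneg_left ?_ (hpipos y).le
      have := Real.sqrt_le_sqrt (show 1 - a y ≤ 1 - min (1 - e) (a y) by
        linarith [min_le_right (1 - e) (a y)])
      linarith
    · rw [Ioc_eq_empty_of_le ((min_le_right _ _).trans (haSc y hy))]
      simp [hy]
  have I3 : ∫ u, ph e u ∂μ = Real.sqrt (1/2) - θ / 2 := by
    have := int_ind kk (1 - e) he1 (by linarith)
    rw [int_kk _ he1 (by linarith), sub_sub_cancel, hse] at this
    exact this
  have I4 : ∫ u, ph e u ^ 2 ∂μ = L / 4 := by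
    have := int_ind (fun u => kk u ^ 2) (1 - e) he1 (by linarith)
    rw [int_kk2 _ he1 (by linarith), sub_sub_cancel] at this
    have h2 : ∀ u, ph e u ^ 2 = (Ioc (1/2 : ℝ) (1 - e)).indicator (fun u => kk u ^ 2) u := by
      intro u
      by_cases hu : u ∈ Ioc (1/2 : ℝ) (1 - e)
      · simp only [ph, indicator_of_mem hu]
      · simp only [ph, indicator_of_notMem hu]
        norm_num
    simp only [h2]
    rw [this, ← Real.log_div (by norm_num) he0.ne', hL]
    congr 2
    rw [he]
    field_simp
    norm_num
  set l := 2 * θ / L with hl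
  have i2 : Integrable (fun u => 1/2 + G u * (1 / (2 * P))) μ :=
    (integrable_const _).add (hiG.mul_const _)
  have i3 : Integrable (fun u => 1/2 + G u * (1 / (2 * P)) - ph e u * (l / 4)) μ :=
    i2.sub (hiph.mul_const _)
  have i4 : Integrable (fun u => 1/2 + G u * (1 / (2 * P)) - ph e u * (l / 4)
      + ph e u * G u * (l / (4 * P))) μ := i3.add (hiphG.mul_const _)
  have hmain : ∫ u in (0:ℝ)..1, Real.sqrt (piS pi (esStep pi p S u) / piS pi S)
      ≤ ∫ u, ((1/2 + G u * (1 / (2 * P)) - ph e u * (l / 4) + ph e u * G u * (l / (4 * P)))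
        + ph e u ^ 2 * (l ^ 2 / 8)) ∂μ := by
    rw [intervalIntegral.integral_of_le zero_le_one]
    refine integral_mono_of_nonneg (Filter.Eventually.of_forall fun u => Real.sqrt_nonneg _) ?_
      (Filter.Eventually.of_forall fun u => ?_)
    · exact i4.add (hiph2.mul_const _)
    · simp only
      rw [hes, hPi]
      have hk := key_pt (G u / P) (l * ph e u) (div_nonneg (hG0 u) hS0.le) ?_
      · refine hk.trans (le_of_eq ?_)
        field_simp
        ring
      · by_cases hu : u ∈ Ioc (1/2 : ℝ) (1 - e)
        · right
          rw [div_le_one hS0]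
          exact hGP u hu.1
        · left
          simp only [ph, indicator_of_notMem hu, mul_zero]
  rw [integral_add i4 (hiph2.mul_const _), integral_add i3 (hiphG.mul_const _),
    integral_sub i2 (hiph.mul_const _), integral_add (integrable_const _) (hiG.mul_const _)] at hmain
  simp only [integral_mul_const, I3, I4] at hmain
  have hc : ∫ _u, (1/2:ℝ) ∂μ = 1 / 2 := by simp [hμ]
  rw [hc] at hmain
  have hl0 : 0 ≤ l := by positivity
  have J1 : (∫ u, G u ∂μ) * (1 / (2 * P)) ≤ 1 / 2 := by
    refine (mul_le_mul_of_nonneg_right I1 (by positivity)).trans (le_of_eq ?_)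
    field_simp
  have J2 : (∫ u, ph e u * G u ∂μ) * (l / (4 * P)) ≤ (Real.sqrt (1/2) - θ) * (l / 4) := by
    refine (mul_le_mul_of_nonneg_right I2 (by positivity)).trans (le_of_eq ?_)
    field_simp
  have J3 : θ ^ 2 / (8 * L) = l * θ / 8 - L / 4 * (l ^ 2 / 8) := by
    rw [hl]
    field_simp
    ring
  rw [J3, psiSet]
  linarith

end EvolvingSetsPaper
end

section
/- Let p be the transition kernel of an irreducible reversible Markov chain on a finite state space V with stationary distribution π, satisfying p(x,x) ≥ 1/2 for all x ∈ V. Let λ_2 be the second largest eigenvalue of p, and let h_2^+ = inf{θ_S : 0 < π(S) ≤ 1/2}, where θ_S = (1/π(S)) Σ_{y∈S} √(π(y) Q(S^c,y)). If h_2^+ > 0, then the spectral gap satisfies 1 − λ_2 ≥ (h_2^+)²/(8 log(2/(h_2^+)²)). -/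
open MeasureTheory Set
open scoped ENNReal Classical

namespace EvolvingSetsPaper

variable {V : Type*}

/-- `h_2^+ = inf { θ_S : 0 < π(S) ≤ 1/2 }`. -/
noncomputable def h2plus (pi : V → ℝ) (p : V → V → ℝ) : ℝ :=
  sInf (thetaS pi p '' {S : Set V | 0 < piS pi S ∧ piS pi S ≤ 1 / 2})

/-- The second largest eigenvalue of an irreducible reversible transition matrix:
the largest eigenvalue different from `1` (for an irreducible chain the
eigenvalue `1` is simple). -/
noncomputable def lambda2 [Fintype V] (p : V → V → ℝ) : ℝ :=
  sSup {l : ℝ | (∃ f : V → ℝ, f ≠ 0 ∧ ∀ x, ∑ y, p x y * f y = l * f x) ∧ l ≠ 1}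

def HasI (f : ℝ → ℝ) (c : ℝ) : Prop := Integrable f ∧ ∫ s, f s = c

lemma HasI.add {f g : ℝ → ℝ} {a b : ℝ} (hf : HasI f a) (hg : HasI g b) :
    HasI (fun s => f s + g s) (a + b) :=
  ⟨hf.1.add hg.1, by rw [integral_add hf.1 hg.1, hf.2, hg.2]⟩

lemma HasI.mul (c : ℝ) {f : ℝ → ℝ} {a : ℝ} (hf : HasI f a) :
    HasI (fun s => c * f s) (c * a) :=
  ⟨hf.1.const_mul c, by rw [integral_const_mul, hf.2]⟩

lemma HasI.sum {ι : Type*} (t : Finset ι) {f : ι → ℝ → ℝ} {a : ι → ℝ}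
    (hf : ∀ i, HasI (f i) (a i)) :
    HasI (fun s => ∑ i ∈ t, f i s) (∑ i ∈ t, a i) :=
  ⟨integrable_finsetSum _ (fun i _ => (hf i).1), by
    rw [integral_finsetSum _ (fun i _ => (hf i).1)]
    exact Finset.sum_congr rfl (fun i _ => (hf i).2)⟩

lemma hasI_deriv {F f : ℝ → ℝ} {a b : ℝ} (hab : a ≤ b)
    (hd : ∀ s ∈ Icc a b, HasDerivAt F (f s) s) (hc : ContinuousOn f (Icc a b)) :
    HasI (fun s => if a ≤ s ∧ s < b then f s else 0) (F b - F a) := by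
  have e : (fun s => if a ≤ s ∧ s < b then f s else 0) = (Ico a b).indicator f := by
    funext s; simp [Set.indicator, Set.mem_Ico]
  rw [e]
  have hi : IntegrableOn f (Icc a b) := hc.integrableOn_Icc
  refine ⟨(integrable_indicator_iff measurableSet_Ico).2 (hi.mono_set Ico_subset_Icc_self), ?_⟩
  rw [integral_indicator measurableSet_Ico, integral_Ico_eq_integral_Ioo,
    ← integral_Ioc_eq_integral_Ioo, ← intervalIntegral.integral_of_le hab]
  apply intervalIntegral.integral_eq_sub_of_hasDerivAt
  · intro x hx; rw [uIcc_of_le hab] at hx; exact hd x hx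
  · apply ContinuousOn.intervalIntegrable; rwa [uIcc_of_le hab]

lemma hasI_sq {G : ℝ} (hG : 0 ≤ G) :
    HasI (fun s => if 0 ≤ s ∧ s < G then 2 * s else 0) (G ^ 2) := by
  have := hasI_deriv (F := fun s => s ^ 2) (f := fun s => 2 * s) hG
    (fun s _ => by simpa using hasDerivAt_pow 2 s) (by fun_prop)
  simpa using this

lemma hasI_tri (a G : ℝ) :
    HasI (fun s => if a ≤ s ∧ s < G then 2 * (G - s) else 0) ((max (G - a) 0) ^ 2) := by
  rcases le_total a G with h | h
  · have := hasI_deriv (F := fun s => -(G - s) ^ 2) (f := fun s => 2 * (G - s)) h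
      (fun s _ => by
        have h1 : HasDerivAt (fun s => G - s) (-1) s := (hasDerivAt_id s).const_sub G
        have h2 : HasDerivAt (fun s => -(G - s) ^ 2) (-(((2 : ℕ) : ℝ) * (G - s) ^ (2 - 1) * -1)) s :=
          (h1.pow 2).neg
        exact h2.congr_deriv (by norm_num)) (by fun_prop)
    rw [max_eq_left (by linarith)]
    convert this using 1
    ring
  · have e : (fun s => if a ≤ s ∧ s < G then 2 * (G - s) else 0) = fun _ => 0 := by
      funext s; rw [if_neg]; rintro ⟨h1, h2⟩; linarith
    rw [e, max_eq_right (by linarith)]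
    exact ⟨integrable_zero _ _ _, by simp⟩

lemma hasI_log {G e : ℝ} (hG : 0 ≤ G) (he : 0 < e) (he1 : e ≤ 1) :
    HasI (fun s => if 0 ≤ s ∧ s < (1 - e) * G then G ^ 2 * (1 / (G - s)) else 0)
      (G ^ 2 * Real.log (1 / e)) := by
  rcases hG.eq_or_lt with h | hG
  · subst h
    refine ⟨?_, ?_⟩ <;> simp
  · have hlt : ∀ s ∈ Icc 0 ((1 - e) * G), 0 < G - s := fun s hs => by
      have := hs.2; nlinarith [mul_pos he hG]
    have := hasI_deriv (F := fun s => - G ^ 2 * Real.log (G - s))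
      (f := fun s => G ^ 2 * (1 / (G - s))) (a := 0) (b := (1 - e) * G)
      (by apply mul_nonneg <;> linarith)
      (fun s hs => by
        have h1 : HasDerivAt (fun s => G - s) (-1) s := (hasDerivAt_id s).const_sub G
        exact ((h1.log (hlt s hs).ne').const_mul (- G ^ 2)).congr_deriv (by ring))
      (by
        apply ContinuousOn.mul continuousOn_const
        apply ContinuousOn.div continuousOn_const (by fun_prop)
        intro s hs; exact (hlt s hs).ne')
    convert this using 1
    have : G - (1 - e) * G = e * G := by ring
    rw [this, Real.log_mul he.ne' hG.ne', one_div, Real.log_inv]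
    simp; ring

lemma hasI_const {G e : ℝ} (hG : 0 ≤ G) (he : 0 < e) :
    HasI (fun s => if (1 - e) * G ≤ s ∧ s < G then G else 0) (e * G ^ 2) := by
  have := hasI_deriv (F := fun s => G * s) (f := fun s => G) (a := (1 - e) * G) (b := G)
    (by nlinarith)
    (fun s _ => by simpa using (hasDerivAt_id s).const_mul G) (by fun_prop)
  convert this using 1
  ring

lemma piS_eq [Fintype V] (pi : V → ℝ) (S : Set V) :
    piS pi S = ∑ y, if y ∈ S then pi y else 0 := by
  rw [piS, tsum_subtype, tsum_fintype]; rfl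

lemma QS_eq [Fintype V] (pi : V → ℝ) (p : V → V → ℝ) 
    (hrev : ∀ x y, pi x * p x y = pi y * p y x) (S : Set V) (y : V) :
    QS pi p S y = pi y * ∑ x, if x ∈ S then p y x else 0 := by
  have : QS pi p S y = ∑ x, if x ∈ S then pi x * p x y else 0 := by
    rw [QS, tsum_subtype S (fun s => pi s * p s y), tsum_fintype]; rfl
  rw [this, Finset.mul_sum]
  refine Finset.sum_congr rfl fun x _ => ?_
  split_ifs
  · exact hrev x y
  · simp

lemma theta_mul [Fintype V] (pi : V → ℝ) (p : V → V → ℝ) 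
    (hpipos : ∀ x, 0 < pi x)
    (hrev : ∀ x y, pi x * p x y = pi y * p y x) (S : Set V) (hS : 0 < piS pi S) :
    thetaS pi p S * piS pi S =
      ∑ y, if y ∈ S then pi y * Real.sqrt (∑ x, if x ∈ S then 0 else p y x) else 0 := by
  have : ∑' y : S, Real.sqrt (pi y * QS pi p Sᶜ y)
      = ∑ y, if y ∈ S then Real.sqrt (pi y * QS pi p Sᶜ y) else 0 := by
    rw [tsum_subtype S (fun y => Real.sqrt (pi y * QS pi p Sᶜ y)), tsum_fintype]; rfl
  rw [thetaS, this, mul_comm, ← mul_assoc, mul_one_div_cancel hS.ne', one_mul]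
  refine Finset.sum_congr rfl fun y _ => ?_
  split_ifs with hy
  · rw [QS_eq pi p hrev, ← mul_assoc, Real.sqrt_mul (mul_self_nonneg _),
      Real.sqrt_mul_self (hpipos y).le]
    congr 2
    refine Finset.sum_congr rfl fun x _ => ?_
    by_cases hx : x ∈ S <;> simp [hx]
  · rfl

lemma h_le_theta [Fintype V] (pi : V → ℝ) (p : V → V → ℝ) (hpipos : ∀ x, 0 < pi x)
    (S : Set V) (hS : 0 < piS pi S) (hS2 : piS pi S ≤ 1 / 2) :
    h2plus pi p ≤ thetaS pi p S := by
  apply csInf_le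
  · exact (Set.toFinite _).bddBelow
  · exact ⟨S, ⟨hS, hS2⟩, rfl⟩

lemma F_le [Fintype V] (p : V → V → ℝ) 
    (hp0 : ∀ x y, 0 ≤ p x y) (hp1 : ∀ x, ∑ y, p x y = 1)
    (hlazy : ∀ x, (1 : ℝ) / 2 ≤ p x x) (S : Set V) (y : V) (hy : y ∈ S) :
    (∑ x, if x ∈ S then 0 else p y x) ≤ 1 / 2 := by
  have h1 : (∑ x, if x ∈ S then 0 else p y x) + ∑ x, (if x = y then p y x else 0) ≤ 1 := by
    rw [← Finset.sum_add_distrib, ← hp1 y]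
    refine Finset.sum_le_sum fun x _ => ?_
    by_cases hxy : x = y
    · subst hxy; simp [hy]
    · simp only [hxy, if_false, add_zero]; split_ifs
      · exact hp0 _ _
      · exact le_rfl
  simp at h1
  have := hlazy y
  linarith

lemma h_sq_le [Fintype V] (p : V → V → ℝ) (pi : V → ℝ)
    (hp0 : ∀ x y, 0 ≤ p x y) (hp1 : ∀ x, ∑ y, p x y = 1)
    (hpipos : ∀ x, 0 < pi x)
    (hrev : ∀ x y, pi x * p x y = pi y * p y x)
    (hlazy : ∀ x, (1 : ℝ) / 2 ≤ p x x)
    (hh : 0 < h2plus pi p) : h2plus pi p ≤ Real.sqrt (1 / 2) := by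
  have hne : (thetaS pi p '' {S : Set V | 0 < piS pi S ∧ piS pi S ≤ 1 / 2}).Nonempty := by
    by_contra hcon
    rw [Set.not_nonempty_iff_eq_empty] at hcon
    rw [h2plus, hcon, Real.sInf_empty] at hh
    exact lt_irrefl _ hh
  obtain ⟨_, S, ⟨hS, hS2⟩, rfl⟩ := hne
  refine (h_le_theta pi p hpipos S hS hS2).trans ?_
  refine le_of_mul_le_mul_right ?_ hS
  rw [theta_mul pi p hpipos hrev S hS, piS_eq, Finset.mul_sum]
  refine Finset.sum_le_sum fun y _ => ?_
  split_ifs with hy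
  · rw [mul_comm]
    exact mul_le_mul_of_nonneg_right (Real.sqrt_le_sqrt (F_le p hp0 hp1 hlazy S y hy)) (hpipos y).le
  · simp

/-- pointwise bound -/
lemma ptwise {G s a e F : ℝ} (ha : 0 < a) (he : 0 < e) (hs : 0 ≤ s) (hsG : s < G)
    (hF0 : 0 ≤ F) (hF : F ≤ 1 / 2) :
    2 * s * Real.sqrt F ≤ a * (2 * (G - s) * F) +
      (1 / (2 * a) * (if 0 ≤ s ∧ s < (1 - e) * G then G ^ 2 * (1 / (G - s)) else 0) +
      Real.sqrt 2 * (if (1 - e) * G ≤ s ∧ s < G then G else 0)) := by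
  have hd : 0 < G - s := by linarith
  by_cases h : s < (1 - e) * G
  · rw [if_pos ⟨hs, h⟩, if_neg (by intro h'; linarith [h'.1])]
    set r := Real.sqrt F
    have hr : r * r = F := Real.mul_self_sqrt hF0
    have hr0 : 0 ≤ r := Real.sqrt_nonneg _
    rw [← hr]
    have h1 : 2 * s * r ≤ 2 * G * r := by nlinarith
    have h2 : a * (2 * (G - s) * (r * r)) + (1 / (2 * a) * (G ^ 2 * (1 / (G - s))) + Real.sqrt 2 * 0)
        - 2 * G * r = (2 * a * (G - s) * r - G) ^ 2 / (2 * a * (G - s)) := by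
      field_simp; ring
    have h3 : 0 ≤ (2 * a * (G - s) * r - G) ^ 2 / (2 * a * (G - s)) := by positivity
    linarith
  · rw [if_neg (by intro h'; exact h h'.2), if_pos ⟨not_lt.1 h, hsG⟩]
    have h1 : Real.sqrt F ≤ Real.sqrt 2 / 2 := by
      apply Real.sqrt_le_iff.2
      refine ⟨by positivity, ?_⟩
      rw [div_pow, Real.sq_sqrt (by norm_num)]; linarith
    have h2 : 0 ≤ a * (2 * (G - s) * F) := by positivity
    have h3 : 0 ≤ Real.sqrt F := Real.sqrt_nonneg _
    nlinarith [Real.sqrt_nonneg 2]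

lemma coarea [Fintype V]
    (p : V → V → ℝ) (pi : V → ℝ)
    (hp0 : ∀ x y, 0 ≤ p x y) (hp1 : ∀ x, ∑ y, p x y = 1)
    (hpipos : ∀ x, 0 < pi x)
    (hrev : ∀ x y, pi x * p x y = pi y * p y x)
    (hlazy : ∀ x, (1 : ℝ) / 2 ≤ p x x)
    (g : V → ℝ) (hg : ∀ x, 0 ≤ g x) (hgs : piS pi {x | 0 < g x} ≤ 1 / 2)
    {a e : ℝ} (ha : 0 < a) (he : 0 < e) (he1 : e ≤ 1) :
    h2plus pi p * ∑ y, pi y * g y ^ 2 ≤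
      ∑ y, pi y * (a * (∑ x, p y x * (max (g y - g x) 0) ^ 2) +
        (1 / (2 * a) * (g y ^ 2 * Real.log (1 / e)) + Real.sqrt 2 * (e * g y ^ 2))) := by
  have hL := HasI.mul (h2plus pi p) (HasI.sum Finset.univ fun y => HasI.mul (pi y) (hasI_sq (hg y)))
  have hR := HasI.sum Finset.univ fun y => HasI.mul (pi y)
    (((HasI.sum Finset.univ fun x => HasI.mul (p y x) (hasI_tri (g x) (g y))).mul a).add
      (((hasI_log (hg y) he he1).mul (1 / (2 * a))).add ((hasI_const (hg y) he).mul (Real.sqrt 2))))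
  rw [← hL.2, ← hR.2]
  refine integral_mono hL.1 hR.1 fun s => ?_
  simp only
  have hRy : ∀ y, 0 ≤ pi y * (a * ∑ x, p y x * (if g x ≤ s ∧ s < g y then 2 * (g y - s) else 0) +
      (1 / (2 * a) * (if 0 ≤ s ∧ s < (1 - e) * g y then g y ^ 2 * (1 / (g y - s)) else 0) +
      Real.sqrt 2 * (if (1 - e) * g y ≤ s ∧ s < g y then g y else 0))) := by
    intro y
    apply mul_nonneg (hpipos y).le
    refine add_nonneg (mul_nonneg ha.le (Finset.sum_nonneg fun x _ => mul_nonneg (hp0 _ _) ?_))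
      (add_nonneg (mul_nonneg (by positivity) ?_) (mul_nonneg (by positivity) ?_))
    · split_ifs with h
      · linarith [h.2]
      · exact le_rfl
    · split_ifs with h
      · have : 0 ≤ g y - s := by nlinarith [h.2, hg y]
        positivity
      · exact le_rfl
    · split_ifs
      · exact hg y
      · exact le_rfl
  by_cases hs : 0 ≤ s
  swap
  · have : (∑ y, pi y * (if 0 ≤ s ∧ s < g y then 2 * s else 0)) = 0 := by simp [hs]
    rw [this, mul_zero]
    exact Finset.sum_nonneg fun y _ => hRy y
  set S : Set V := {y | s < g y} with hSdef
  have e1 : (∑ y, pi y * (if 0 ≤ s ∧ s < g y then 2 * s else 0)) = 2 * s * piS pi S := by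
    rw [piS_eq, Finset.mul_sum]
    refine Finset.sum_congr rfl fun y _ => ?_
    simp only [hs, true_and, hSdef, mem_setOf_eq]
    split_ifs <;> ring
  rw [e1]
  have hS0 : 0 ≤ piS pi S := by
    rw [piS_eq]; refine Finset.sum_nonneg fun y _ => ?_
    split_ifs
    · exact (hpipos y).le
    · exact le_rfl
  rcases hS0.eq_or_lt with h0 | hSpos
  · rw [← h0]; simp only [mul_zero]
    exact Finset.sum_nonneg fun y _ => hRy y
  have hS2 : piS pi S ≤ 1 / 2 := by
    refine le_trans ?_ hgs
    rw [piS_eq, piS_eq]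
    refine Finset.sum_le_sum fun y _ => ?_
    by_cases hy : y ∈ S
    · have : y ∈ {x | 0 < g x} := lt_of_le_of_lt hs hy
      simp only [if_pos hy, if_pos this, le_refl]
    · rw [if_neg hy]; split_ifs
      · exact (hpipos y).le
      · exact le_rfl
  have h1 := mul_le_mul_of_nonneg_right (h_le_theta pi p hpipos S hSpos hS2) hS0
  rw [theta_mul pi p hpipos hrev S hSpos] at h1
  have h2 : h2plus pi p * (2 * s * piS pi S) = 2 * s * (h2plus pi p * piS pi S) := by ring
  rw [h2]
  refine (mul_le_mul_of_nonneg_left h1 (by positivity)).trans ?_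
  rw [Finset.mul_sum]
  refine Finset.sum_le_sum fun y _ => ?_
  by_cases hy : y ∈ S
  · rw [if_pos hy]
    have hyS : s < g y := hy
    have hpt := ptwise (G := g y) ha he hs hyS
      (F := ∑ x, if x ∈ S then 0 else p y x)
      (Finset.sum_nonneg fun x _ => by
        split_ifs
        · exact le_rfl
        · exact hp0 _ _)
      (F_le p hp0 hp1 hlazy S y hy)
    have e2 : ∑ x, p y x * (if g x ≤ s ∧ s < g y then 2 * (g y - s) else 0)
        = 2 * (g y - s) * ∑ x, if x ∈ S then 0 else p y x := by
      rw [Finset.mul_sum]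
      refine Finset.sum_congr rfl fun x _ => ?_
      by_cases hx : x ∈ S
      · have hx' : s < g x := hx
        rw [if_pos hx, if_neg (by rintro ⟨h, _⟩; linarith)]; ring
      · have hx' : g x ≤ s := not_lt.1 hx
        rw [if_neg hx, if_pos ⟨hx', hyS⟩]; ring
    rw [e2]
    have := mul_le_mul_of_nonneg_left hpt (hpipos y).le
    refine le_trans (le_of_eq ?_) this
    ring
  · rw [if_neg hy, mul_zero]; exact hRy y

lemma dirichlet [Fintype V]
    (p : V → V → ℝ) (pi : V → ℝ) (hp1 : ∀ x, ∑ y, p x y = 1)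
    (hrev : ∀ x y, pi x * p x y = pi y * p y x) (g : V → ℝ) :
    ∑ y, pi y * ∑ x, p y x * (max (g y - g x) 0) ^ 2 =
      ∑ y, pi y * (g y * (g y - ∑ x, p y x * g x)) := by
  set A := ∑ y, ∑ x, pi y * p y x * (max (g y - g x) 0) ^ 2 with hA
  have hA' : A = ∑ y, ∑ x, pi y * p y x * (max (g x - g y) 0) ^ 2 := by
    rw [hA, Finset.sum_comm]
    refine Finset.sum_congr rfl fun y _ => Finset.sum_congr rfl fun x _ => ?_
    rw [hrev]
  set B := ∑ y, ∑ x, pi y * p y x * (g y * (g y - g x)) with hB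
  have hB' : B = ∑ y, ∑ x, pi y * p y x * (g x * (g x - g y)) := by
    rw [hB, Finset.sum_comm]
    refine Finset.sum_congr rfl fun y _ => Finset.sum_congr rfl fun x _ => ?_
    rw [hrev]
  have h2 : A + A = B + B := by
    nth_rewrite 2 [hA']
    nth_rewrite 2 [hB']
    rw [hA, hB, ← Finset.sum_add_distrib, ← Finset.sum_add_distrib]
    refine Finset.sum_congr rfl fun y _ => ?_
    rw [← Finset.sum_add_distrib, ← Finset.sum_add_distrib]
    refine Finset.sum_congr rfl fun x _ => ?_
    rcases le_total (g x) (g y) with h | h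
    · rw [max_eq_left (by linarith), max_eq_right (by linarith)]; ring
    · rw [max_eq_right (by linarith), max_eq_left (by linarith)]; ring
  have h3 : A = B := by linarith
  have e1 : ∑ y, pi y * ∑ x, p y x * (max (g y - g x) 0) ^ 2 = A := by
    rw [hA]
    refine Finset.sum_congr rfl fun y _ => ?_
    rw [Finset.mul_sum]
    refine Finset.sum_congr rfl fun x _ => by ring
  have e2 : ∑ y, pi y * (g y * (g y - ∑ x, p y x * g x)) = B := by
    rw [hB]
    refine Finset.sum_congr rfl fun y _ => ?_
    have : g y - ∑ x, p y x * g x = ∑ x, p y x * (g y - g x) := by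
      simp only [mul_sub, Finset.sum_sub_distrib, ← Finset.sum_mul, hp1, one_mul]
    rw [this, Finset.mul_sum, Finset.mul_sum]
    refine Finset.sum_congr rfl fun x _ => by ring
  rw [e1, e2, h3]

lemma gap_aux [Fintype V]
    (p : V → V → ℝ) (pi : V → ℝ)
    (hp0 : ∀ x y, 0 ≤ p x y) (hp1 : ∀ x, ∑ y, p x y = 1)
    (hpipos : ∀ x, 0 < pi x)
    (hrev : ∀ x y, pi x * p x y = pi y * p y x)
    (hlazy : ∀ x, (1 : ℝ) / 2 ≤ p x x)
    (hh : 0 < h2plus pi p) (l : ℝ) (f : V → ℝ)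
    (hf : ∀ x, ∑ y, p x y * f y = l * f x)
    (hfp : ∃ x, 0 < f x) (hfs : piS pi {x | 0 < f x} ≤ 1 / 2) :
    h2plus pi p ^ 2 / (8 * Real.log (2 / h2plus pi p ^ 2)) ≤ 1 - l := by
  set h := h2plus pi p with hdef
  have hle : h ≤ Real.sqrt (1 / 2) := h_sq_le p pi hp0 hp1 hpipos hrev hlazy hh
  have hsq : h ^ 2 ≤ 1 / 2 := by
    have := pow_le_pow_left₀ hh.le hle 2
    rwa [Real.sq_sqrt (by norm_num)] at this
  have h22 : Real.sqrt 2 * Real.sqrt 2 = 2 := Real.mul_self_sqrt (by norm_num)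
  have h2p : 0 < Real.sqrt 2 := by positivity
  set e := h / (2 * Real.sqrt 2) with he_def
  have he : 0 < e := by positivity
  have h1 : h ≤ 1 := by nlinarith
  have hs1 : 1 ≤ Real.sqrt 2 := by nlinarith
  have hse : Real.sqrt 2 * e = h / 2 := by rw [he_def]; field_simp
  have he1 : e ≤ 1 := by nlinarith
  have hlog : Real.log (1 / e) ≤ Real.log (2 / h ^ 2) := by
    apply Real.log_le_log (by positivity)
    rw [div_le_div_iff₀ he (by positivity)]
    have : Real.sqrt 2 * h ≤ 1 := by
      by_contra hc
      push Not at hc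
      nlinarith
    nlinarith
  set L := Real.log (2 / h ^ 2) with hLdef
  have hL : 0 < L := by
    apply Real.log_pos
    rw [lt_div_iff₀ (by positivity)]; linarith
  set g : V → ℝ := fun x => max (f x) 0 with hg
  have hg0 : ∀ x, 0 ≤ g x := fun x => le_max_right _ _
  have hgs : piS pi {x | 0 < g x} ≤ 1 / 2 := by
    have : {x | 0 < g x} = {x | 0 < f x} := by
      ext x; simp [hg]
    rwa [this]
  have ha : 0 < 2 * L / h := by positivity
  have hco := coarea p pi hp0 hp1 hpipos hrev hlazy g hg0 hgs ha he he1
  set N := ∑ y, pi y * g y ^ 2 with hN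
  have hNpos : 0 < N := by
    obtain ⟨x, hx⟩ := hfp
    apply Finset.sum_pos'
    · intro y _; have := hpipos y; positivity
    · refine ⟨x, Finset.mem_univ _, mul_pos (hpipos x) (pow_pos ?_ 2)⟩
      exact lt_max_of_lt_left hx
  have hD : ∑ y, pi y * ∑ x, p y x * (max (g y - g x) 0) ^ 2 ≤ (1 - l) * N := by
    rw [dirichlet p pi hp1 hrev g, hN, Finset.mul_sum]
    refine Finset.sum_le_sum fun y _ => ?_
    have : g y * (g y - ∑ x, p y x * g x) ≤ (1 - l) * g y ^ 2 := by
      rcases le_or_gt (f y) 0 with hy | hy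
      · have : g y = 0 := max_eq_right hy
        rw [this]; simp
      · have hgy : g y = f y := max_eq_left hy.le
        have : l * f y ≤ ∑ x, p y x * g x := by
          rw [← hf y]
          exact Finset.sum_le_sum fun x _ => mul_le_mul_of_nonneg_left (le_max_left _ _) (hp0 _ _)
        rw [hgy]
        nlinarith
    have := mul_le_mul_of_nonneg_left this (hpipos y).le
    linarith
  set D := ∑ y, pi y * ∑ x, p y x * (max (g y - g x) 0) ^ 2 with hDdef
  have hsplit : ∑ y, pi y * (2 * L / h * (∑ x, p y x * (max (g y - g x) 0) ^ 2) +
        (1 / (2 * (2 * L / h)) * (g y ^ 2 * Real.log (1 / e)) + Real.sqrt 2 * (e * g y ^ 2)))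
      = 2 * L / h * D + (1 / (2 * (2 * L / h)) * Real.log (1 / e) + Real.sqrt 2 * e) * N := by
    rw [hDdef, hN, Finset.mul_sum, Finset.mul_sum, ← Finset.sum_add_distrib]
    refine Finset.sum_congr rfl fun y _ => by ring
  rw [hsplit, hse] at hco
  have hb : 1 / (2 * (2 * L / h)) * Real.log (1 / e) ≤ h / 4 := by
    calc _ ≤ 1 / (2 * (2 * L / h)) * L := mul_le_mul_of_nonneg_left hlog (by positivity)
      _ = h / 4 := by field_simp; ring
  have hc : h * N ≤ (2 * L / h * (1 - l) + (h / 4 + h / 2)) * N := by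
    have := mul_le_mul_of_nonneg_left hD ha.le
    have := mul_le_mul_of_nonneg_right hb hNpos.le
    nlinarith
  have hfin := le_of_mul_le_mul_right hc hNpos
  rw [div_le_iff₀ (by positivity)]
  have h4 : h / 4 ≤ 2 * L / h * (1 - l) := by linarith
  have h5 := mul_le_mul_of_nonneg_left h4 hh.le
  have h6 : h * (2 * L / h * (1 - l)) = 2 * L * (1 - l) := by field_simp
  nlinarith

/-- Theorem (concluding remark 3, spectral form): for a reversible lazy chain,
`1 - λ₂ ≥ (h₂⁺)² / (8 log(2/(h₂⁺)²))`. -/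
theorem spectral_gap_ge_h2plus [Fintype V] [Nonempty V]
    (p : V → V → ℝ) (pi : V → ℝ)
    (hp0 : ∀ x y, 0 ≤ p x y) (hp1 : ∀ x, ∑ y, p x y = 1)
    (hpipos : ∀ x, 0 < pi x) (hpi1 : ∑ x, pi x = 1)
    (hstat : ∀ y, ∑ x, pi x * p x y = pi y)
    (hrev : ∀ x y, pi x * p x y = pi y * p y x)
    (hirr : ∀ x y : V, ∃ n, 0 < pn p n x y)
    (hlazy : ∀ x, (1 : ℝ) / 2 ≤ p x x)
    (hh : 0 < h2plus pi p) :
    h2plus pi p ^ 2 / (8 * Real.log (2 / h2plus pi p ^ 2)) ≤ 1 - lambda2 p := by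
  have hle := h_sq_le p pi hp0 hp1 hpipos hrev hlazy hh
  have hsq : h2plus pi p ^ 2 ≤ 1 / 2 := by
    have := pow_le_pow_left₀ hh.le hle 2
    rwa [Real.sq_sqrt (by norm_num)] at this
  rcases Set.eq_empty_or_nonempty
    {l : ℝ | (∃ f : V → ℝ, f ≠ 0 ∧ ∀ x, ∑ y, p x y * f y = l * f x) ∧ l ≠ 1} with hem | hne
  · rw [lambda2, hem, Real.sSup_empty, sub_zero]
    have h0 : 0 < h2plus pi p ^ 2 := by positivity
    have h4 : Real.log 2 ≤ Real.log (2 / h2plus pi p ^ 2) := by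
      apply Real.log_le_log (by norm_num)
      rw [le_div_iff₀ h0]; linarith
    have := Real.log_two_gt_d9
    rw [div_le_one (by linarith)]
    linarith
  · have : lambda2 p ≤ 1 - h2plus pi p ^ 2 / (8 * Real.log (2 / h2plus pi p ^ 2)) := by
      apply csSup_le hne
      rintro l ⟨⟨f, hf0, hf⟩, hl⟩
      have hmean : ∑ x, pi x * f x = 0 := by
        have h1 : ∑ x, pi x * (l * f x) = ∑ x, pi x * f x := by
          simp_rw [← hf, Finset.mul_sum]
          rw [Finset.sum_comm]
          refine Finset.sum_congr rfl fun y _ => ?_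
          rw [show pi y * f y = (∑ x, pi x * p x y) * f y by rw [hstat y], Finset.sum_mul]
          refine Finset.sum_congr rfl fun x _ => by ring
        have h2 : ∑ x, pi x * (l * f x) = l * ∑ x, pi x * f x := by
          rw [Finset.mul_sum]
          refine Finset.sum_congr rfl fun x _ => by ring
        have h3 : (l - 1) * ∑ x, pi x * f x = 0 := by linarith
        exact (mul_eq_zero.1 h3).resolve_left (sub_ne_zero.2 hl)
      have hpos : ∀ k : V → ℝ, k ≠ 0 → ∑ x, pi x * k x = 0 → ∃ x, 0 < k x := by
        intro k hk hm
        by_contra hc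
        push Not at hc
        apply hk
        have := (Finset.sum_eq_zero_iff_of_nonpos (fun x _ =>
          mul_nonpos_of_nonneg_of_nonpos (hpipos x).le (hc x))).1 hm
        funext x
        exact (mul_eq_zero.1 (this x (Finset.mem_univ _))).resolve_left (hpipos x).ne'
      rcases le_or_gt (piS pi {x | 0 < f x}) (1 / 2) with hS | hS
      · have := gap_aux p pi hp0 hp1 hpipos hrev hlazy hh l f hf (hpos f hf0 hmean) hS
        linarith
      · have hS' : piS pi {x | 0 < (-f) x} ≤ 1 / 2 := by
          have : piS pi {x | 0 < f x} + piS pi {x | 0 < (-f) x} ≤ 1 := by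
            rw [piS_eq, piS_eq, ← Finset.sum_add_distrib, ← hpi1]
            refine Finset.sum_le_sum fun x _ => ?_
            simp only [mem_setOf_eq, Pi.neg_apply]
            have := hpipos x
            split_ifs <;> linarith
          linarith
        have := gap_aux p pi hp0 hp1 hpipos hrev hlazy hh l (-f)
          (fun x => by simp [hf x])
          (hpos (-f) (neg_ne_zero.2 hf0) (by simp [hmean])) hS'
        linarith
    linarith

end EvolvingSetsPaper
end

section
/- Let p be the transition kernel of an irreducible reversible Markov chain on a finite state space V with stationary distribution π, and let λ_2 be its second largest eigenvalue. Then λ_2 ≤ 1 − ψ_*, where ψ_* = inf{ψ(S) : 0 < π(S) ≤ 1/2}; that is, ψ_* is a lower bound for the spectral gap 1 − λ_2. -/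
open MeasureTheory Set
open scoped ENNReal Classical

namespace EvolvingSetsPaper

variable {V : Type*}

/-- `ψ_* = inf { ψ(S) : 0 < π(S) ≤ 1/2 }`. -/
noncomputable def psiStar (pi : V → ℝ) (p : V → V → ℝ) : ℝ :=
  sInf (psiSet pi p '' {S : Set V | 0 < piS pi S ∧ piS pi S ≤ 1 / 2})

theorem aux_piS [Fintype V] (pi : V → ℝ) (S : Set V) :
    piS pi S = ∑ y, S.indicator pi y := by
  unfold piS
  rw [tsum_subtype S pi, tsum_fintype]

theorem aux_QS [Fintype V] (pi : V → ℝ) (p : V → V → ℝ) (S : Set V) (y : V) :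
    QS pi p S y = ∑ s, S.indicator (fun s => pi s * p s y) s := by
  unfold QS
  rw [tsum_subtype S (fun s => pi s * p s y), tsum_fintype]

theorem aux_int (a : ℝ) (h0 : 0 ≤ a) (h1 : a ≤ 1) :
    ∫ u in (0:ℝ)..1, (if u ≤ a then (1:ℝ) else 0) = a := by
  have e : (fun u : ℝ => if u ≤ a then (1:ℝ) else 0) = (Set.Iic a).indicator (fun _ => 1) := by
    ext u; simp [Set.indicator]
  rw [e, intervalIntegral.integral_of_le zero_le_one,
    MeasureTheory.setIntegral_indicator measurableSet_Iic]
  have : Set.Ioc (0:ℝ) 1 ∩ Set.Iic a = Set.Ioc 0 a := by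
    ext u; simp only [Set.mem_inter_iff, Set.mem_Ioc, Set.mem_Iic]
    constructor
    · rintro ⟨⟨h, _⟩, h'⟩; exact ⟨h, h'⟩
    · rintro ⟨h, h'⟩; exact ⟨⟨h, h'.trans h1⟩, h'⟩
  rw [this]
  simp [h0]

theorem aux_intble (a : ℝ) :
    IntervalIntegrable (fun u : ℝ => if u ≤ a then (1:ℝ) else 0) volume 0 1 := by
  apply AntitoneOn.intervalIntegrable
  intro u _ v _ huv
  dsimp only
  split_ifs with h1 h2
  · exact le_rfl
  · exact absurd (huv.trans h1) h2
  · exact zero_le_one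
  · exact le_rfl

theorem aux_piS_mono [Fintype V] (pi : V → ℝ) (hpipos : ∀ x, 0 < pi x) {S T : Set V}
    (h : S ⊆ T) : piS pi S ≤ piS pi T := by
  rw [aux_piS, aux_piS]
  exact Finset.sum_le_sum fun y _ =>
    Set.indicator_le_indicator_of_subset h (fun x => (hpipos x).le) y

theorem aux_step [Fintype V]
    (p : V → V → ℝ) (pi : V → ℝ)
    (hp0 : ∀ x y, 0 ≤ p x y)
    (hpipos : ∀ x, 0 < pi x)
    (hstat : ∀ y, ∑ x, pi x * p x y = pi y) (f : V → ℝ) (S : Set V) :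
    ∫ u in (0:ℝ)..1, piS (fun x => pi x * f x) (esStep pi p S u) =
      ∑ y, QS pi p S y * f y := by
  have e : ∀ u : ℝ, piS (fun x => pi x * f x) (esStep pi p S u) =
      ∑ y, (if u ≤ QS pi p S y / pi y then (1:ℝ) else 0) * (pi y * f y) := by
    intro u
    rw [aux_piS]
    refine Finset.sum_congr rfl fun y _ => ?_
    simp only [Set.indicator, esStep, Set.mem_setOf_eq, le_div_iff₀ (hpipos y)]
    split_ifs <;> simp
  simp_rw [e]
  rw [intervalIntegral.integral_finset_sum fun y _ => (aux_intble _).mul_const _]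
  refine Finset.sum_congr rfl fun y _ => ?_
  rw [intervalIntegral.integral_mul_const, aux_int]
  · have := (hpipos y).ne'
    field_simp
  · rw [aux_QS]
    exact div_nonneg (Finset.sum_nonneg fun s _ => Set.indicator_nonneg
      (fun x _ => mul_nonneg (hpipos x).le (hp0 x y)) s) (hpipos y).le
  · rw [div_le_one (hpipos y), aux_QS]
    conv_rhs => rw [← hstat y]
    exact Finset.sum_le_sum fun s _ => Set.indicator_le_self' 
      (fun x _ => mul_nonneg (hpipos x).le (hp0 x y)) s

theorem aux_psiStar_le [Fintype V] (p : V → V → ℝ) (pi : V → ℝ) (S : Set V)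
    (h0 : 0 < piS pi S) (h1 : piS pi S ≤ 1 / 2) : psiStar pi p ≤ psiSet pi p S :=
  csInf_le (Set.toFinite _).bddBelow ⟨S, ⟨h0, h1⟩, rfl⟩

theorem aux_main [Fintype V] [Nonempty V]
    (p : V → V → ℝ) (pi : V → ℝ)
    (hp0 : ∀ x y, 0 ≤ p x y)
    (hpipos : ∀ x, 0 < pi x) (hpi1 : ∑ x, pi x = 1)
    (hstat : ∀ y, ∑ x, pi x * p x y = pi y)
    (hrev : ∀ x y, pi x * p x y = pi y * p y x)
    (l : ℝ) (f : V → ℝ) (hf : f ≠ 0) (hl : ∀ x, ∑ y, p x y * f y = l * f x) (hl1 : l ≠ 1) :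
    l ≤ 1 - psiStar pi p := by
  set g : V → ℝ := fun x => pi x * f x with hg
  -- mean zero
  have hm : ∑ x, g x = 0 := by
    have h1 : ∑ x, pi x * ∑ y, p x y * f y = ∑ x, g x := by
      simp_rw [Finset.mul_sum]
      rw [Finset.sum_comm]
      refine Finset.sum_congr rfl fun y _ => ?_
      simp_rw [← mul_assoc]
      rw [← Finset.sum_mul, hstat]
    have h2 : ∑ x, pi x * ∑ y, p x y * f y = l * ∑ x, g x := by
      rw [Finset.mul_sum]
      refine Finset.sum_congr rfl fun y _ => ?_
      rw [hl, hg]; ring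
    have h3 : (l - 1) * ∑ x, g x = 0 := by linarith
    exact (mul_eq_zero.1 h3).resolve_left (sub_ne_zero.2 hl1)
  have hcompl : ∀ (q : V → ℝ) (S : Set V), piS q S + piS q Sᶜ = ∑ x, q x := by
    intro q S
    rw [aux_piS, aux_piS, ← Finset.sum_add_distrib]
    refine Finset.sum_congr rfl fun y _ => ?_
    exact congrFun (Set.indicator_self_add_compl S q) y
  have hnn : ∀ S : Set V, 0 ≤ piS pi S := fun S => by
    rw [aux_piS]
    exact Finset.sum_nonneg fun s _ => Set.indicator_nonneg (fun x _ => (hpipos x).le) s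
  have hempty : ∀ q : V → ℝ, piS q ∅ = 0 := fun q => by simp [aux_piS]
  have hpos : ∀ S : Set V, S ≠ ∅ → 0 < piS pi S := by
    intro S hS
    obtain ⟨x, hx⟩ := Set.nonempty_iff_ne_empty.2 hS
    rw [aux_piS]
    refine Finset.sum_pos' (fun s _ => Set.indicator_nonneg (fun x _ => (hpipos x).le) s)
      ⟨x, Finset.mem_univ _, ?_⟩
    rw [Set.indicator_of_mem hx]; exact hpipos x
  obtain ⟨S0, hS0, hmax⟩ := Set.exists_max_image {S : Set V | piS pi S ≤ 1 / 2}
    (fun S => |piS g S| / √(piS pi S)) (Set.toFinite _)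
    ⟨∅, by simp [hempty]⟩
  set N := |piS g S0| / √(piS pi S0) with hN
  have hS0' : piS pi S0 ≤ 1 / 2 := hS0
  have hN0 : 0 ≤ N := by positivity
  have hsmall : ∀ S : Set V, piS pi S ≤ 1 / 2 → |piS g S| ≤ N * √(piS pi S) := by
    intro S hS
    by_cases he : S = ∅
    · subst he; simp [hempty]
    · have := hmax S hS
      exact (div_le_iff₀ (Real.sqrt_pos.2 (hpos S he))).1 this
  have hall : ∀ S : Set V, |piS g S| ≤ N * √(piS pi S) := by
    intro S
    rcases le_total (piS pi S) (1/2) with h | h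
    · exact hsmall S h
    · have h1 := hcompl pi S
      have h2 := hcompl g S
      rw [hpi1] at h1
      rw [hm] at h2
      have h3 : piS g S = - piS g Sᶜ := by linarith
      rw [h3, abs_neg]
      refine (hsmall Sᶜ (by linarith)).trans ?_
      gcongr
      linarith
  have hNpos : 0 < N := by
    refine lt_of_le_of_ne hN0 fun h => hf ?_
    funext x
    have h1 := hall {x}
    rw [← h, zero_mul] at h1
    have h2 : piS g {x} = g x := by
      simp [piS]
    have h3 : g x = 0 := by rw [← h2]; exact abs_eq_zero.1 (le_antisymm h1 (abs_nonneg _))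
    exact (mul_eq_zero.1 h3).resolve_left (hpipos x).ne'
  have hS0ne : S0 ≠ ∅ := by
    rintro rfl
    rw [hN, hempty] at hNpos
    simp at hNpos
  have hS0pos := hpos S0 hS0ne
  have hsq : 0 < √(piS pi S0) := Real.sqrt_pos.2 hS0pos
  have hkey : l * piS g S0 = ∫ u in (0:ℝ)..1, piS g (esStep pi p S0 u) := by
    rw [aux_step p pi hp0 hpipos hstat f S0, aux_piS]
    simp_rw [aux_QS, Finset.sum_mul]
    rw [Finset.sum_comm, Finset.mul_sum]
    refine Finset.sum_congr rfl fun s _ => ?_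
    by_cases hs : s ∈ S0
    · simp only [Set.indicator_of_mem hs, hg, mul_assoc]
      rw [← Finset.mul_sum, hl]; ring
    · simp [Set.indicator_of_notMem hs]
  have hint : IntervalIntegrable (fun u => √(piS pi (esStep pi p S0 u))) volume 0 1 := by
    apply AntitoneOn.intervalIntegrable
    intro u _ v _ huv
    apply Real.sqrt_le_sqrt
    apply aux_piS_mono pi hpipos
    intro y hy
    simp only [esStep, Set.mem_setOf_eq] at hy ⊢
    exact (mul_le_mul_of_nonneg_right huv (hpipos y).le).trans hy
  have hbd : |l * piS g S0| ≤ ∫ u in (0:ℝ)..1, N * √(piS pi (esStep pi p S0 u)) := by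
    rw [hkey, ← Real.norm_eq_abs]
    refine intervalIntegral.norm_integral_le_of_norm_le zero_le_one ?_ (hint.const_mul N)
    exact Filter.Eventually.of_forall fun u _ => hall _
  have hpsi : ∫ u in (0:ℝ)..1, √(piS pi (esStep pi p S0 u)) =
      (1 - psiSet pi p S0) * √(piS pi S0) := by
    unfold psiSet
    simp_rw [Real.sqrt_div (hnn _)]
    rw [intervalIntegral.integral_div]
    field_simp
    ring
  rw [intervalIntegral.integral_const_mul, hpsi] at hbd
  have hfin : l * (N * √(piS pi S0)) ≤ (1 - psiSet pi p S0) * (N * √(piS pi S0)) := by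
    have h1 : |piS g S0| = N * √(piS pi S0) := by
      rw [hN]; field_simp
    rw [← h1]
    calc l * |piS g S0| ≤ |l| * |piS g S0| := by gcongr; exact le_abs_self l
      _ = |l * piS g S0| := (abs_mul _ _).symm
      _ ≤ _ := hbd
      _ = (1 - psiSet pi p S0) * |piS g S0| := by rw [h1]; ring
  have := le_of_mul_le_mul_right hfin (mul_pos hNpos hsq)
  have := aux_psiStar_le p pi S0 hS0pos hS0'
  linarith

/-- Concluding remark 2: `ψ_*` is a lower bound for the spectral gap, i.e.
`λ₂ ≤ 1 - ψ_*`. -/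
theorem lambda2_le_one_sub_psiStar [Fintype V] [Nonempty V]
    (p : V → V → ℝ) (pi : V → ℝ)
    (hp0 : ∀ x y, 0 ≤ p x y) (hp1 : ∀ x, ∑ y, p x y = 1)
    (hpipos : ∀ x, 0 < pi x) (hpi1 : ∑ x, pi x = 1)
    (hstat : ∀ y, ∑ x, pi x * p x y = pi y)
    (hrev : ∀ x y, pi x * p x y = pi y * p y x)
    (hirr : ∀ x y : V, ∃ n, 0 < pn p n x y) :
    lambda2 p ≤ 1 - psiStar pi p := by
  apply Real.sSup_le
  · rintro l ⟨⟨f, hf, hl⟩, hl1⟩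
    exact aux_main p pi hp0 hpipos hpi1 hstat hrev l f hf hl hl1
  · by_cases h : ∃ S : Set V, 0 < piS pi S ∧ piS pi S ≤ 1 / 2
    · obtain ⟨S, h0, h1⟩ := h
      have h2 := aux_psiStar_le p pi S h0 h1
      have h3 : psiSet pi p S ≤ 1 := by
        unfold psiSet
        have := intervalIntegral.integral_nonneg (μ := volume) (zero_le_one (α := ℝ))
          (fun u _ => Real.sqrt_nonneg (piS pi (esStep pi p S u) / piS pi S))
        linarith
      linarith
    · have : {S : Set V | 0 < piS pi S ∧ piS pi S ≤ 1 / 2} = ∅ := by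
        ext S; simp only [Set.mem_setOf_eq, Set.mem_empty_iff_false, iff_false]
        exact fun hS => h ⟨S, hS⟩
      unfold psiStar
      rw [this]; simp

end EvolvingSetsPaper
end
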